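/- arXiv:2008.01417 — 3 statements merged into one kernel-verified Lean document; each statement's English description precedes it below -/
import Mathlib

section
/- Let n be a positive integer with n ≡ 1 (mod 4). Then the sum over k from 0 to (n−1)/4 of [8k+1] · (q;q^4)_k^4 / (q^4;q^4)_k^4 · q^{2k} is congruent to ((q^2;q^4)_{(n−1)/4} / (q^4;q^4)_{(n−1)/4}) · [n] · q^{(1−n)/4} modulo [n]·Φ_n(q)^2. -/
open Polynomial Finset

/-- The q-shifted factorial `(x; r)_k = (1-x)(1-x r)⋯(1-x r^(k-1))`. -/
noncomputable def qPoch {F : Type*} [Field F] (x r : F) (k : ℕ) : F :=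
  ∏ i ∈ Finset.range k, (1 - x * r ^ i)

/-- The q-integer `[z] = (1-q^z)/(1-q)` (for an arbitrary integer `z`). -/
noncomputable def qInt {F : Type*} [Field F] (q : F) (z : ℤ) : F :=
  (1 - q ^ z) / (1 - q)

/-- The rational function `x ∈ ℚ(q)` is ≡ 0 modulo the polynomial `M`:
its numerator in lowest terms is divisible by `M`, i.e. `x = M·f/g` with `g` coprime to `M`. -/
def ratCongr (M : Polynomial ℚ) (x : RatFunc ℚ) : Prop :=
  ∃ f g : Polynomial ℚ, IsCoprime M g ∧
    x * algebraMap (Polynomial ℚ) (RatFunc ℚ) g =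
      algebraMap (Polynomial ℚ) (RatFunc ℚ) M * algebraMap (Polynomial ℚ) (RatFunc ℚ) f

/-- The `k`-th term of a terminating very-well-poised `₆φ₅` series in base `p` with the parameters
`a, c, d, p ^ (-N)`, without its very-well-poised factor `1 - a * p ^ (2 * k)`. -/
def wellPoisedProd {F : Type*} [Field F] (a c d p : F) (N k : ℕ) : F :=
  ∏ i ∈ range k,
    (1 - a * p ^ i) * (1 - c * p ^ i) * (1 - d * p ^ i) * (p ^ N - p ^ i) * (a * p) /
      ((1 - p ^ (i + 1)) * (c - a * p ^ (i + 1)) * (d - a * p ^ (i + 1)) *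
        (1 - a * p ^ (N + 1 + i)))

section WellPoised

variable {F : Type*} [Field F] {a c d p : F}

lemma prod_pow_sub_pow_succ (p : F) (N k : ℕ) :
    (p ^ (N + 1) - 1) * p ^ k * ∏ i ∈ range k, (p ^ N - p ^ i) =
      (p ^ (N + 1) - p ^ k) * ∏ i ∈ range k, (p ^ (N + 1) - p ^ i) := by
  induction k with
  | zero => simp
  | succ k ih =>
    rw [prod_range_succ, prod_range_succ]
    linear_combination (p * (p ^ N - p ^ k)) * ih

lemma prod_one_sub_shift (a p : F) (N k : ℕ) :
    (1 - a * p ^ (N + 1)) * ∏ i ∈ range k, (1 - a * p ^ (N + 2 + i)) =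
      (1 - a * p ^ (N + 1 + k)) * ∏ i ∈ range k, (1 - a * p ^ (N + 1 + i)) := by
  induction k with
  | zero => simp
  | succ k ih =>
    rw [prod_range_succ, prod_range_succ]
    linear_combination (1 - a * p ^ (N + 2 + k)) * ih

lemma wellPoisedProd_succ_left (hp0 : p ≠ 0) (hp : ∀ i : ℕ, 1 - p ^ (i + 1) ≠ 0)
    (ha : ∀ i : ℕ, 1 - a * p ^ (i + 1) ≠ 0) (N k : ℕ) :
    wellPoisedProd a c d p N k =
      (p ^ (N + 1) - p ^ k) * (1 - a * p ^ (N + 1 + k)) /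
        ((p ^ (N + 1) - 1) * p ^ k * (1 - a * p ^ (N + 1))) *
        wellPoisedProd a c d p (N + 1) k := by
  have h1 := prod_pow_sub_pow_succ p N k
  have h2 := prod_one_sub_shift a p N k
  have e1 : p ^ (N + 1) - 1 ≠ 0 := by
    have := hp N
    contrapose! this
    linear_combination -this
  have e2 : p ^ k ≠ 0 := pow_ne_zero _ hp0
  have e3 := ha N
  have e4 : ∏ i ∈ range k, (1 - a * p ^ (N + 1 + i)) ≠ 0 := by
    refine prod_ne_zero_iff.2 fun i _ => ?_
    rw [show N + 1 + i = N + i + 1 by ring]; exact ha _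
  have e5 : ∏ i ∈ range k, (1 - a * p ^ (N + 2 + i)) ≠ 0 := by
    refine prod_ne_zero_iff.2 fun i _ => ?_
    rw [show N + 2 + i = N + i + 1 + 1 by ring]; exact ha _
  have key : (∏ i ∈ range k, (p ^ N - p ^ i)) / ∏ i ∈ range k, (1 - a * p ^ (N + 1 + i)) =
      (p ^ (N + 1) - p ^ k) * (1 - a * p ^ (N + 1 + k)) /
        ((p ^ (N + 1) - 1) * p ^ k * (1 - a * p ^ (N + 1))) *
      ((∏ i ∈ range k, (p ^ (N + 1) - p ^ i)) / ∏ i ∈ range k, (1 - a * p ^ (N + 2 + i))) := by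
    rw [div_mul_div_comm, div_eq_div_iff e4 (by positivity)]
    linear_combination (1 - a * p ^ (N + 1)) * (∏ i ∈ range k, (1 - a * p ^ (N + 2 + i))) * h1 +
      (p ^ (N + 1) - p ^ k) * (∏ i ∈ range k, (p ^ (N + 1) - p ^ i)) * h2
  simp only [wellPoisedProd, prod_div_distrib, prod_mul_distrib]
  rw [show N + 1 + 1 = N + 2 by ring]
  simp only [mul_div_mul_comm, ← mul_assoc] at key ⊢
  linear_combination (((∏ i ∈ range k, (1 - a * p ^ i)) / ∏ i ∈ range k, (1 - p ^ (i + 1))) *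
    ((∏ i ∈ range k, (1 - c * p ^ i)) / ∏ i ∈ range k, (c - a * p ^ (i + 1))) *
    ((∏ i ∈ range k, (1 - d * p ^ i)) / ∏ i ∈ range k, (d - a * p ^ (i + 1))) *
    ((∏ i ∈ range k, a) * (∏ i ∈ range k, p))) * key

lemma sum_wellPoised_telescope (hp0 : p ≠ 0) (hp : ∀ i : ℕ, 1 - p ^ (i + 1) ≠ 0)
    (ha : ∀ i : ℕ, 1 - a * p ^ (i + 1) ≠ 0) (hc : ∀ i : ℕ, c - a * p ^ (i + 1) ≠ 0)
    (hd : ∀ i : ℕ, d - a * p ^ (i + 1) ≠ 0) (N m : ℕ) :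
    ∑ k ∈ range m, ((c - a * p ^ (N + 1)) * (d - a * p ^ (N + 1)) *
        ((1 - a * p ^ (2 * k)) * wellPoisedProd a c d p (N + 1) k) -
      (1 - a * p ^ (N + 1)) * (c * d - a * p ^ (N + 1)) *
        ((1 - a * p ^ (2 * k)) * wellPoisedProd a c d p N k)) =
    p ^ (N + 1) * (1 - p ^ m) * (c - a * p ^ m) * (d - a * p ^ m) * (1 - a * p ^ (N + 1 + m)) /
      ((p ^ (N + 1) - 1) * p ^ m) * wellPoisedProd a c d p (N + 1) m := by
  have e1 : p ^ (N + 1) - 1 ≠ 0 := by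
    have := hp N
    contrapose! this
    linear_combination -this
  induction m with
  | zero => simp
  | succ m ih =>
    rw [sum_range_succ, ih, wellPoisedProd_succ_left hp0 hp ha N m]
    have e2 : p ^ m ≠ 0 := pow_ne_zero _ hp0
    have e3 := ha N
    have e4 := hp m
    have e5 := hc m
    have e6 := hd m
    have e7 := ha (N + m + 1)
    rw [show wellPoisedProd a c d p (N + 1) (m + 1) = wellPoisedProd a c d p (N + 1) m *
      ((1 - a * p ^ m) * (1 - c * p ^ m) * (1 - d * p ^ m) * (p ^ (N + 1) - p ^ m) * (a * p) /
      ((1 - p ^ (m + 1)) * (c - a * p ^ (m + 1)) * (d - a * p ^ (m + 1)) *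
        (1 - a * p ^ (N + 1 + 1 + m)))) from prod_range_succ _ _]
    rw [show N + m + 1 + 1 = N + 1 + 1 + m by ring] at e7
    generalize wellPoisedProd a c d p (N + 1) m = W
    rw [show p ^ (N + 1 + 1 + m) = p ^ N * p * p * p ^ m by ring] at e7 ⊢
    rw [show p ^ (N + 1 + m) = p ^ N * p * p ^ m by ring,
      show p ^ (N + 1 + (m + 1)) = p ^ N * p * p * p ^ m by ring,
      show p ^ (2 * m) = p ^ m * p ^ m by ring]
    rw [pow_succ p m] at e4 e5 e6 ⊢
    rw [pow_succ p N] at e1 e3 ⊢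
    generalize p ^ m = K at *
    generalize p ^ N = Q at *
    generalize 1 - K * p = D₁ at *
    generalize c - a * (K * p) = D₂ at *
    generalize d - a * (K * p) = D₃ at *
    generalize 1 - a * (Q * p * p * K) = D₄ at *
    generalize hY : Q * p - 1 = Y at *
    generalize hZ : 1 - a * (Q * p) = Z at *
    field_simp
    subst hY hZ
    ring

/-- The terminating `₆φ₅` summation. -/
theorem sum_wellPoised (hp0 : p ≠ 0) (hp : ∀ i : ℕ, 1 - p ^ (i + 1) ≠ 0)
    (ha : ∀ i : ℕ, 1 - a * p ^ (i + 1) ≠ 0) (hc : ∀ i : ℕ, c - a * p ^ (i + 1) ≠ 0)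
    (hd : ∀ i : ℕ, d - a * p ^ (i + 1) ≠ 0) (N : ℕ) :
    ∑ k ∈ range (N + 1), (1 - a * p ^ (2 * k)) * wellPoisedProd a c d p N k =
      (1 - a) * ∏ i ∈ range N, (1 - a * p ^ (i + 1)) * (c * d - a * p ^ (i + 1)) /
        ((c - a * p ^ (i + 1)) * (d - a * p ^ (i + 1))) := by
  have hvanish (N : ℕ) : wellPoisedProd a c d p N (N + 1) = 0 :=
    prod_eq_zero (self_mem_range_succ N) (by simp)
  induction N with
  | zero => simp [wellPoisedProd]
  | succ N ih =>
    have h := sum_wellPoised_telescope hp0 hp ha hc hd N (N + 2)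
    rw [hvanish (N + 1), mul_zero, sum_sub_distrib, ← mul_sum, ← mul_sum,
      sum_range_succ (fun k => (1 - a * p ^ (2 * k)) * wellPoisedProd a c d p N k) (N + 1),
      hvanish N, mul_zero, add_zero, ih, sub_eq_zero] at h
    rw [prod_range_succ, ← mul_assoc, mul_div_assoc', eq_div_iff (mul_ne_zero (hc N) (hd N))]
    linear_combination h

end WellPoised

section DeformedSum

/-- The quadratic factor `s * (1 - x * q ^ a) * (1 - q ^ a / x)`, written in the symmetric variable
`w = s * (x + x⁻¹ - 2)`, times `(1 - q ^ a) ^ 2`. -/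
def quadFactor {R : Type*} [CommRing R] (s q w : R) (a : ℕ) : R :=
  (s * (1 - q ^ a) ^ 2 - q ^ a * w) * (1 - q ^ a) ^ 2

/-- The common denominator of the deformed sum. -/
def deformedDen {R : Type*} [CommRing R] (s q w : R) (N : ℕ) : R :=
  ∏ i ∈ range N, quadFactor s q w (4 * i + 4)

/-- The numerator of the deformed sum over the common denominator `deformedDen`. -/
def deformedNum {R : Type*} [CommRing R] (s q w : R) (N : ℕ) : R :=
  ∑ k ∈ range (N + 1), (1 - q ^ (8 * k + 1)) * q ^ (2 * k) *
    ((∏ i ∈ range k, quadFactor s q w (4 * i + 1)) * ∏ i ∈ Ico k N, quadFactor s q w (4 * i + 4))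

variable {R S : Type*} [CommRing R] [CommRing S]

lemma map_quadFactor (φ : R →+* S) (s q w : R) (a : ℕ) :
    φ (quadFactor s q w a) = quadFactor (φ s) (φ q) (φ w) a := by
  simp [quadFactor]

lemma map_deformedDen (φ : R →+* S) (s q w : R) (N : ℕ) :
    φ (deformedDen s q w N) = deformedDen (φ s) (φ q) (φ w) N := by
  simp [deformedDen, map_quadFactor]

lemma map_deformedNum (φ : R →+* S) (s q w : R) (N : ℕ) :
    φ (deformedNum s q w N) = deformedNum (φ s) (φ q) (φ w) N := by
  simp [deformedNum, map_quadFactor]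

lemma quadFactor_reflect {q : R} {a b : ℕ} (h : q ^ (a + b) = 1) (w : R) :
    quadFactor 1 q w a = q ^ (4 * a) * quadFactor 1 q w b := by
  have h' : q ^ a * q ^ b = 1 := by rw [← pow_add, h]
  rw [quadFactor, quadFactor, pow_mul']
  generalize q ^ a = x at *
  generalize q ^ b = y at *
  have e1 : x ^ 2 * (1 - y) ^ 2 = (1 - x) ^ 2 := by
    linear_combination (x * y + 1 - 2 * x) * h'
  have e2 : x ^ 2 * (1 * (1 - y) ^ 2 - y * w) = 1 * (1 - x) ^ 2 - x * w := by
    linear_combination e1 - w * x * h'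
  rw [← e2, ← e1]
  ring

lemma prod_quadFactor_reflect {q : R} {N : ℕ} (h : q ^ (4 * N + 1) = 1) (w : R) {k : ℕ}
    (hk : k ≤ N) :
    ∏ i ∈ range k, quadFactor 1 q w (4 * i + 1) =
      q ^ (4 * k * (2 * k - 1)) * ∏ i ∈ Ico (N - k) N, quadFactor 1 q w (4 * i + 4) := by
  induction k with
  | zero => simp
  | succ k ih =>
    have hI : Ico (N - (k + 1)) N = insert (N - (k + 1)) (Ico (N - k) N) := by
      ext i; simp only [mem_insert, mem_Ico]; omega
    rw [prod_range_succ, ih (by omega), hI, prod_insert (by simp; omega),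
      quadFactor_reflect (a := 4 * k + 1) (b := 4 * (N - (k + 1)) + 4)
        (by rw [← h]; congr 1; omega)]
    have : 4 * (k + 1) * (2 * (k + 1) - 1) = 4 * k * (2 * k - 1) + 4 * (4 * k + 1) := by
      obtain _ | k := k
      · rfl
      · rw [show 2 * (k + 1 + 1) - 1 = 2 * k + 3 by omega,
          show 2 * (k + 1) - 1 = 2 * k + 1 by omega]
        ring
    rw [this, pow_add]
    ring

/-- The antisymmetry `k ↦ N - k` of the terms of the deformed sum at a root of unity. -/
theorem deformedNum_eq_neg {q : R} {N : ℕ} (h : q ^ (4 * N + 1) = 1) (w : R) :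
    deformedNum 1 q w N = -deformedNum 1 q w N := by
  rw [eq_neg_iff_add_eq_zero]
  unfold deformedNum
  nth_rw 2 [← sum_flip]
  rw [← sum_add_distrib]
  refine sum_eq_zero fun k hk => ?_
  obtain ⟨m, rfl⟩ : ∃ m, N = k + m := ⟨N - k, by rw [mem_range] at hk; omega⟩
  rw [prod_quadFactor_reflect h w (by omega), prod_quadFactor_reflect h w (Nat.sub_le _ _)]
  simp only [Nat.add_sub_cancel_left, Nat.add_sub_cancel]
  have key (k m : ℕ) (h : q ^ (4 * (k + m) + 1) = 1) :
      q ^ (2 * k) * q ^ (4 * k * (2 * k - 1)) =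
        q ^ (8 * m + 1) * (q ^ (2 * m) * q ^ (4 * m * (2 * m - 1))) := by
    have hm : 2 * m + 4 * m * (2 * m - 1) + 2 * m = 8 * m ^ 2 := by
      obtain _ | m := m
      · rfl
      · rw [show 2 * (m + 1) - 1 = 2 * m + 1 by omega]
        ring
    have hk : 2 * k + 4 * k * (2 * k - 1) + 2 * k = 8 * k ^ 2 := by
      obtain _ | k := k
      · rfl
      · rw [show 2 * (k + 1) - 1 = 2 * k + 1 by omega]
        ring
    have e (j : ℕ) : q ^ ((4 * (k + m) + 1) * j) = 1 := by rw [pow_mul, h, one_pow]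
    simp only [← pow_add]
    generalize 2 * k + 4 * k * (2 * k - 1) = A at *
    generalize 2 * m + 4 * m * (2 * m - 1) = B at *
    calc q ^ A = q ^ (A + (4 * (k + m) + 1) * (2 * m + 1)) := by rw [pow_add, e, mul_one]
      _ = q ^ (8 * m + 1 + B + (4 * (k + m) + 1) * (2 * k)) := by congr 1; linarith
      _ = q ^ (8 * m + 1 + B) := by rw [pow_add, e, mul_one]
  have h1 := key k m h
  have h2 := key m k (by rwa [add_comm m k])
  generalize ∏ i ∈ Ico m (k + m), quadFactor 1 q w (4 * i + 4) = P
  generalize ∏ i ∈ Ico k (k + m), quadFactor 1 q w (4 * i + 4) = P'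
  linear_combination (P * P') * (h1 + h2)

end DeformedSum

/-- The rational function `x` is regular at `ζ` and takes the value `z` there. -/
def SpecializesTo (ζ : ℂ) (x : RatFunc ℚ) (z : ℂ) : Prop :=
  ∃ f g : ℚ[X], aeval ζ g ≠ 0 ∧
    x * algebraMap ℚ[X] (RatFunc ℚ) g = algebraMap ℚ[X] (RatFunc ℚ) f ∧
    aeval ζ f = z * aeval ζ g

namespace SpecializesTo

variable {ζ z w : ℂ} {x y : RatFunc ℚ}

lemma of_polynomial (ζ : ℂ) (f : ℚ[X]) :
    SpecializesTo ζ (algebraMap ℚ[X] (RatFunc ℚ) f) (aeval ζ f) :=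
  ⟨f, 1, by simp, by simp, by simp⟩

lemma X (ζ : ℂ) : SpecializesTo ζ RatFunc.X ζ := by
  simpa using of_polynomial ζ Polynomial.X

lemma natCast (ζ : ℂ) (m : ℕ) : SpecializesTo ζ m m := by
  simpa using of_polynomial ζ (m : ℚ[X])

lemma zero (ζ : ℂ) : SpecializesTo ζ 0 0 := by simpa using natCast ζ 0

lemma one (ζ : ℂ) : SpecializesTo ζ 1 1 := by simpa using natCast ζ 1

lemma add (hx : SpecializesTo ζ x z) (hy : SpecializesTo ζ y w) :
    SpecializesTo ζ (x + y) (z + w) := by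
  obtain ⟨f, g, hg, e, e'⟩ := hx
  obtain ⟨f', g', hg', h, h'⟩ := hy
  refine ⟨f * g' + f' * g, g * g', by simp [hg, hg'], ?_, ?_⟩
  · simp only [map_add, map_mul, ← e, ← h]; ring
  · simp only [map_add, map_mul, e', h']; ring

lemma mul (hx : SpecializesTo ζ x z) (hy : SpecializesTo ζ y w) :
    SpecializesTo ζ (x * y) (z * w) := by
  obtain ⟨f, g, hg, e, e'⟩ := hx
  obtain ⟨f', g', hg', h, h'⟩ := hy
  refine ⟨f * f', g * g', by simp [hg, hg'], ?_, ?_⟩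
  · simp only [map_mul, ← e, ← h]; ring
  · simp only [map_mul, e', h']; ring

lemma neg (hx : SpecializesTo ζ x z) : SpecializesTo ζ (-x) (-z) := by
  obtain ⟨f, g, hg, e, e'⟩ := hx
  exact ⟨-f, g, hg, by simp [e], by simp [e']⟩

lemma sub (hx : SpecializesTo ζ x z) (hy : SpecializesTo ζ y w) :
    SpecializesTo ζ (x - y) (z - w) := by
  simpa only [sub_eq_add_neg] using hx.add hy.neg

lemma inv (hx : SpecializesTo ζ x z) (hz : z ≠ 0) : SpecializesTo ζ x⁻¹ z⁻¹ := by
  obtain ⟨f, g, hg, e, e'⟩ := hx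
  have hf : aeval ζ f ≠ 0 := by rw [e']; exact mul_ne_zero hz hg
  have hf0 : algebraMap ℚ[X] (RatFunc ℚ) f ≠ 0 := by
    rw [Ne, map_eq_zero_iff _ (RatFunc.algebraMap_injective ℚ)]
    rintro rfl
    simp at hf
  have hx0 : x ≠ 0 := by
    rintro rfl
    rw [zero_mul] at e
    exact hf0 e.symm
  refine ⟨g, f, hf, ?_, ?_⟩
  · rw [← e]; field_simp
  · rw [e']; field_simp

lemma div (hx : SpecializesTo ζ x z) (hy : SpecializesTo ζ y w) (hw : w ≠ 0) :
    SpecializesTo ζ (x / y) (z / w) := by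
  simpa only [div_eq_mul_inv] using hx.mul (hy.inv hw)

lemma pow (hx : SpecializesTo ζ x z) (m : ℕ) : SpecializesTo ζ (x ^ m) (z ^ m) := by
  induction m with
  | zero => simpa using one ζ
  | succ m ih => simpa only [pow_succ] using ih.mul hx

lemma sum {ι : Type*} {s : Finset ι} {x : ι → RatFunc ℚ} {z : ι → ℂ}
    (h : ∀ i ∈ s, SpecializesTo ζ (x i) (z i)) :
    SpecializesTo ζ (∑ i ∈ s, x i) (∑ i ∈ s, z i) := by
  classical
  induction s using Finset.induction_on with
  | empty => simpa using zero ζ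
  | insert a s ha ih =>
    rw [sum_insert ha, sum_insert ha]
    exact (h a (mem_insert_self _ _)).add (ih fun i hi => h i (mem_insert_of_mem hi))

lemma prod {ι : Type*} {s : Finset ι} {x : ι → RatFunc ℚ} {z : ι → ℂ}
    (h : ∀ i ∈ s, SpecializesTo ζ (x i) (z i)) :
    SpecializesTo ζ (∏ i ∈ s, x i) (∏ i ∈ s, z i) := by
  classical
  induction s using Finset.induction_on with
  | empty => simpa using one ζ
  | insert a s ha ih =>
    rw [prod_insert ha, prod_insert ha]
    exact (h a (mem_insert_self _ _)).mul (ih fun i hi => h i (mem_insert_of_mem hi))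

lemma one_sub_X_pow (ζ : ℂ) (m : ℕ) :
    SpecializesTo ζ (1 - RatFunc.X ^ m) (1 - ζ ^ m) :=
  (one ζ).sub ((X ζ).pow m)

end SpecializesTo

lemma one_sub_ratFuncX_pow_ne_zero {m : ℕ} (hm : m ≠ 0) :
    (1 - RatFunc.X ^ m : RatFunc ℚ) ≠ 0 := by
  rw [← RatFunc.algebraMap_X, ← map_pow, ← map_one (algebraMap ℚ[X] (RatFunc ℚ)), ← map_sub, Ne,
    map_eq_zero_iff _ (RatFunc.algebraMap_injective ℚ), ← neg_eq_zero, neg_sub]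
  exact X_pow_sub_C_ne_zero (Nat.pos_of_ne_zero hm) (1 : ℚ)

/-- The quotient `(1 - q ^ (d * j)) / (1 - q ^ (d * l))` is regular at `d`-th roots of unity. -/
lemma exists_specializesTo_ratio_mul {ζ : ℂ} {d : ℕ} (hd : d ≠ 0) (hζ : ζ ^ d = 1) (j : ℕ) {l : ℕ}
    (hl : l ≠ 0) :
    ∃ z, SpecializesTo ζ ((1 - RatFunc.X ^ (d * j)) / (1 - RatFunc.X ^ (d * l))) z := by
  have e (j : ℕ) : (1 - RatFunc.X ^ (d * j) : RatFunc ℚ) =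
      (1 - RatFunc.X ^ d) * ∑ t ∈ range j, (RatFunc.X ^ d) ^ t := by
    rw [mul_neg_geom_sum, pow_mul]
  have s (j : ℕ) : SpecializesTo ζ (∑ t ∈ range j, (RatFunc.X ^ d) ^ t) j := by
    have := SpecializesTo.sum (s := range j) fun t _ => ((SpecializesTo.X ζ).pow d).pow t
    simpa [hζ] using this
  rw [e, e, mul_div_mul_left _ _ (one_sub_ratFuncX_pow_ne_zero hd)]
  exact ⟨_, (s j).div (s l) (Nat.cast_ne_zero.2 hl)⟩

/-- The quotient `(q ^ e; q ^ 4)_k / (q ^ 4; q ^ 4)_k`. -/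
noncomputable def qRatio {F : Type*} [Field F] (q : F) (e k : ℕ) : F :=
  ∏ i ∈ range k, (1 - q ^ (4 * i + e)) / (1 - q ^ (4 * i + 4))

lemma qPoch_div_qPoch {F : Type*} [Field F] (q : F) (e k : ℕ) :
    qPoch (q ^ e) (q ^ 4) k / qPoch (q ^ 4) (q ^ 4) k = qRatio q e k := by
  simp only [qPoch, qRatio, prod_div_distrib, ← pow_mul, ← pow_add, add_comm]

section RootOfUnity

variable {ζ : ℂ} {d : ℕ}

lemma one_sub_pow_ne_zero (hζ : IsPrimitiveRoot ζ d) {a : ℕ} (ha : ¬ d ∣ a) : 1 - ζ ^ a ≠ 0 := by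
  rw [sub_ne_zero]
  exact fun h => ha ((hζ.pow_eq_one_iff_dvd a).1 h.symm)

lemma not_dvd_four_mul (hd : d.Coprime 4) {r : ℕ} (hr : r + 1 < d) : ¬ d ∣ 4 * r + 4 := by
  intro h
  have := hd.dvd_of_dvd_mul_left (show d ∣ 4 * (r + 1) by simpa [mul_add] using h)
  exact absurd (Nat.le_of_dvd (by omega) this) (by omega)

lemma specializesTo_qRatio_block (hζ : IsPrimitiveRoot ζ d) (hd : d.Coprime 4) (e m : ℕ) {r : ℕ}
    (hr : r < d) :
    SpecializesTo ζ (∏ i ∈ range r, (1 - RatFunc.X ^ (4 * (d * m + i) + e)) /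
      (1 - RatFunc.X ^ (4 * (d * m + i) + 4))) (qRatio ζ e r) := by
  refine SpecializesTo.prod fun i hi => ?_
  have hi := mem_range.1 hi
  have h (e : ℕ) : SpecializesTo ζ (1 - RatFunc.X ^ (4 * (d * m + i) + e))
      (1 - ζ ^ (4 * i + e)) := by
    have := SpecializesTo.one_sub_X_pow ζ (4 * (d * m + i) + e)
    rwa [show 4 * (d * m + i) + e = d * (4 * m) + (4 * i + e) by ring, pow_add ζ, pow_mul ζ,
      hζ.pow_eq_one, one_pow, one_mul,
      ← show 4 * (d * m + i) + e = d * (4 * m) + (4 * i + e) by ring]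
      at this
  exact (h e).div (h 4) (one_sub_pow_ne_zero hζ (not_dvd_four_mul hd (by omega)))

lemma exists_specializesTo_qRatio_block (hζ : IsPrimitiveRoot ζ d) (hd : d.Coprime 4) {e i₀ : ℕ}
    (hi₀ : i₀ < d) (he : d ∣ 4 * i₀ + e) (m : ℕ) :
    ∃ z, SpecializesTo ζ (∏ i ∈ range d, (1 - RatFunc.X ^ (4 * (d * m + i) + e)) /
      (1 - RatFunc.X ^ (4 * (d * m + i) + 4))) z := by
  obtain ⟨j, hj⟩ := he
  obtain ⟨D, rfl⟩ : ∃ D, d = D + 1 := ⟨d - 1, by omega⟩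
  rw [prod_div_distrib, ← mul_prod_erase _ _ (mem_range.2 hi₀), prod_range_succ,
    mul_comm (∏ _ ∈ _, _),
    mul_div_mul_comm]
  obtain ⟨z, hz⟩ := exists_specializesTo_ratio_mul (d := D + 1) (by omega) hζ.pow_eq_one (4 * m + j)
    (show 4 * m + 4 ≠ 0 by omega)
  rw [show (D + 1) * (4 * m + j) = 4 * ((D + 1) * m + i₀) + e by rw [mul_add, ← hj]; ring,
    show (D + 1) * (4 * m + 4) = 4 * ((D + 1) * m + D) + 4 by ring] at hz
  refine ⟨_, hz.mul (SpecializesTo.div (SpecializesTo.prod fun i _ => .one_sub_X_pow ζ _)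
    (SpecializesTo.prod fun i _ => .one_sub_X_pow ζ _) ?_)⟩
  refine prod_ne_zero_iff.2 fun i hi => one_sub_pow_ne_zero hζ fun h => ?_
  have hi := mem_range.1 hi
  refine not_dvd_four_mul hd (r := i) (by omega) ?_
  rw [show 4 * ((D + 1) * m + i) + 4 = (D + 1) * (4 * m) + (4 * i + 4) by ring] at h
  exact (Nat.dvd_add_right (Dvd.intro _ rfl)).1 h

lemma qRatio_add {F : Type*} [Field F] (q : F) (e k r : ℕ) :
    qRatio q e (k + r) = qRatio q e k *
      ∏ i ∈ range r, (1 - q ^ (4 * (k + i) + e)) / (1 - q ^ (4 * (k + i) + 4)) :=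
  prod_range_add _ _ _

lemma exists_specializesTo_qRatio_mul (hζ : IsPrimitiveRoot ζ d) (hd : d.Coprime 4) {e i₀ : ℕ}
    (hi₀ : i₀ < d) (he : d ∣ 4 * i₀ + e) (m : ℕ) :
    ∃ z, SpecializesTo ζ (qRatio RatFunc.X e (d * m)) z := by
  induction m with
  | zero => exact ⟨1, by simpa [qRatio] using SpecializesTo.one ζ⟩
  | succ m ih =>
    obtain ⟨z, hz⟩ := ih
    obtain ⟨w, hw⟩ := exists_specializesTo_qRatio_block hζ hd hi₀ he m
    exact ⟨z * w, by rw [mul_add, mul_one, qRatio_add]; exact hz.mul hw⟩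

lemma exists_specializesTo_qRatio_mul_add (hζ : IsPrimitiveRoot ζ d) (hd : d.Coprime 4) {e i₀ : ℕ}
    (hi₀ : i₀ < d) (he : d ∣ 4 * i₀ + e) (m : ℕ) :
    ∃ z, ∀ r < d, SpecializesTo ζ (qRatio RatFunc.X e (d * m + r)) (z * qRatio ζ e r) := by
  obtain ⟨z, hz⟩ := exists_specializesTo_qRatio_mul hζ hd hi₀ he m
  exact ⟨z, fun r hr => by
    rw [qRatio_add]; exact hz.mul (specializesTo_qRatio_block hζ hd e m hr)⟩

/-- The `k`-th summand, multiplied by `1 - q`. -/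
noncomputable def summand {F : Type*} [Field F] (q : F) (k : ℕ) : F :=
  (1 - q ^ (8 * k + 1)) * qRatio q 1 k ^ 4 * q ^ (2 * k)

lemma qRatio_eq_zero (hζ : ζ ^ d = 1) {e i₀ k : ℕ} (he : d ∣ 4 * i₀ + e) (hk : i₀ < k) :
    qRatio ζ e k = 0 := by
  refine prod_eq_zero (mem_range.2 hk) ?_
  obtain ⟨j, hj⟩ := he
  rw [hj, pow_mul, hζ, one_pow, sub_self, zero_div]

/-- The deformed sum at `w = 0`. -/
lemma sum_summand_eq {F : Type*} [Field F] (q : F) (N : ℕ)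
    (hq : ∀ i < N, 1 - q ^ (4 * i + 4) ≠ 0) (s : F) :
    (∑ k ∈ range (N + 1), summand q k) * deformedDen s q 0 N = deformedNum s q 0 N := by
  unfold deformedNum deformedDen
  rw [sum_mul]
  refine sum_congr rfl fun k hk => ?_
  have hk : k ≤ N := by rw [mem_range] at hk; omega
  rw [← prod_range_mul_prod_Ico _ hk, ← mul_assoc, ← mul_assoc]
  congr 1
  rw [summand, qRatio, ← prod_pow]
  suffices (∏ i ∈ range k, ((1 - q ^ (4 * i + 1)) / (1 - q ^ (4 * i + 4))) ^ 4) *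
      ∏ i ∈ range k, quadFactor s q 0 (4 * i + 4) = ∏ i ∈ range k, quadFactor s q 0 (4 * i + 1) by
    rw [← this]; ring
  rw [← prod_mul_distrib]
  refine prod_congr rfl fun i hi => ?_
  have := hq i (by rw [mem_range] at hi; omega)
  rw [quadFactor, quadFactor]
  field_simp
  ring

lemma sum_summand_rootOfUnity (hζ : IsPrimitiveRoot ζ d) (hd : d.Coprime 4) {N : ℕ}
    (hN : N < d) (hN' : d ∣ 4 * N + 1) : ∑ r ∈ range (N + 1), summand ζ r = 0 := by
  have hq (i : ℕ) (hi : i < N) : 1 - ζ ^ (4 * i + 4) ≠ 0 :=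
    one_sub_pow_ne_zero hζ (not_dvd_four_mul hd (by omega))
  have h := sum_summand_eq ζ N hq 1
  rw [self_eq_neg.1 (deformedNum_eq_neg ((hζ.pow_eq_one_iff_dvd _).2 hN') 0)] at h
  refine (mul_eq_zero.1 h).resolve_right (prod_ne_zero_iff.2 fun i hi => ?_)
  have := hq i (mem_range.1 hi)
  simp [quadFactor, this]

theorem specializesTo_sum_summand (hζ : IsPrimitiveRoot ζ d) (hd : d.Coprime 4) {N : ℕ}
    (hN : d ∣ 4 * N + 1) (hd0 : 0 < d) :
    SpecializesTo ζ (∑ k ∈ range (N + 1), summand RatFunc.X k) 0 := by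
  have hlt : N % d < d := Nat.mod_lt _ hd0
  have hmod : d ∣ 4 * (N % d) + 1 := by
    rw [← Nat.div_add_mod N d, show 4 * (d * (N / d) + N % d) + 1 =
      d * (4 * (N / d)) + (4 * (N % d) + 1) by ring] at hN
    exact (Nat.dvd_add_right (Dvd.intro _ rfl)).1 hN
  have hpart := sum_summand_rootOfUnity hζ hd hlt hmod
  have hterm (m : ℕ) : ∃ z, ∀ r < d,
      SpecializesTo ζ (summand RatFunc.X (d * m + r)) (z * summand ζ r) := by
    obtain ⟨z, hz⟩ := exists_specializesTo_qRatio_mul_add hζ hd hlt hmod m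
    refine ⟨z ^ 4, fun r hr => ?_⟩
    have h1 := SpecializesTo.one_sub_X_pow ζ (8 * (d * m + r) + 1)
    have h2 := (SpecializesTo.X ζ).pow (2 * (d * m + r))
    have := (h1.mul ((hz r hr).pow 4)).mul h2
    have e1 : ζ ^ (8 * (d * m + r) + 1) = ζ ^ (8 * r + 1) := by
      rw [show 8 * (d * m + r) + 1 = d * (8 * m) + (8 * r + 1) by ring, pow_add, pow_mul,
        hζ.pow_eq_one, one_pow, one_mul]
    have e2 : ζ ^ (2 * (d * m + r)) = ζ ^ (2 * r) := by
      rw [show 2 * (d * m + r) = d * (2 * m) + 2 * r by ring, pow_add, pow_mul,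
        hζ.pow_eq_one, one_pow, one_mul]
    rw [e1, e2] at this
    rw [show z ^ 4 * summand ζ r =
      (1 - ζ ^ (8 * r + 1)) * (z * qRatio ζ 1 r) ^ 4 * ζ ^ (2 * r) by rw [summand]; ring]
    exact this
  have hblock (m R : ℕ) (hR : R ≤ d) (h0 : ∑ r ∈ range R, summand ζ r = 0) :
      SpecializesTo ζ (∑ r ∈ range R, summand RatFunc.X (d * m + r)) 0 := by
    obtain ⟨z, hz⟩ := hterm m
    have := SpecializesTo.sum fun r hr => hz r ((mem_range.1 hr).trans_le hR)
    rwa [← mul_sum, h0, mul_zero] at this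
  have hfull : ∑ r ∈ range d, summand ζ r = 0 := by
    rw [← hpart]
    refine (sum_subset (range_subset_range.2 hlt) fun r _ hr => ?_).symm
    rw [mem_range, not_lt] at hr
    rw [summand, qRatio_eq_zero hζ.pow_eq_one hmod (by omega)]
    simp
  have hfulls (m : ℕ) : SpecializesTo ζ (∑ k ∈ range (d * m), summand RatFunc.X k) 0 := by
    induction m with
    | zero => simpa using SpecializesTo.zero ζ
    | succ m ih =>
      rw [mul_add, mul_one, sum_range_add]
      simpa using ih.add (hblock m d le_rfl hfull)
  rw [← Nat.div_add_mod N d, add_assoc, sum_range_add]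
  simpa using (hfulls (N / d)).add (hblock (N / d) _ hlt hpart)

end RootOfUnity

section Evaluation

variable {F : Type*} [Field F] {q : F}

lemma quadFactor_eq_mul {R : Type*} [CommRing R] (q : R) (n a : ℕ) :
    quadFactor (q ^ n) q ((1 - q ^ n) ^ 2) a =
      (q ^ n - q ^ a) * (1 - q ^ a * q ^ n) * (1 - q ^ a) ^ 2 := by
  rw [quadFactor]; ring

lemma wellPoisedProd_eq_quadFactor (hq : q ≠ 0) (hinj : Function.Injective fun m : ℕ => q ^ m)
    {N k : ℕ} (hk : k ≤ N) :
    wellPoisedProd q (q ^ (4 * N + 2)) q (q ^ 4) N k *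
        ∏ i ∈ range k, quadFactor (q ^ (4 * N + 1)) q ((1 - q ^ (4 * N + 1)) ^ 2) (4 * i + 4) =
      q ^ (2 * k) *
        ∏ i ∈ range k, quadFactor (q ^ (4 * N + 1)) q ((1 - q ^ (4 * N + 1)) ^ 2) (4 * i + 1) := by
  rw [pow_mul, ← card_range k, ← prod_const, card_range, wellPoisedProd, ← prod_mul_distrib,
    ← prod_mul_distrib]
  refine prod_congr rfl fun i hi => ?_
  have hi : i < N := by rw [mem_range] at hi; omega
  have h1 : 1 - q ^ (4 * i + 4) ≠ 0 := sub_ne_zero.2 fun h =>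
    absurd (@hinj 0 (4 * i + 4) (by simpa using h)) (by omega)
  have h2 : q ^ (4 * N + 1) - q ^ (4 * i + 4) ≠ 0 := sub_ne_zero.2 fun h =>
    absurd (hinj h) (by omega)
  have h3 : 1 - q ^ (4 * i + 4) * q ^ (4 * N + 1) ≠ 0 := sub_ne_zero.2 fun h =>
    absurd (@hinj 0 (4 * i + 4 + (4 * N + 1)) (by simpa [pow_add] using h)) (by omega)
  rw [quadFactor_eq_mul, quadFactor_eq_mul,
    show 1 - (q ^ 4) ^ (i + 1) = 1 - q ^ (4 * i + 4) by ring,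
    show q ^ (4 * N + 2) - q * (q ^ 4) ^ (i + 1) = q * (q ^ (4 * N + 1) - q ^ (4 * i + 4)) by ring,
    show q - q * (q ^ 4) ^ (i + 1) = q * (1 - q ^ (4 * i + 4)) by ring,
    show 1 - q * (q ^ 4) ^ (N + 1 + i) = 1 - q ^ (4 * i + 4) * q ^ (4 * N + 1) by ring]
  generalize 1 - q ^ (4 * i + 4) = D₁ at *
  generalize q ^ (4 * N + 1) - q ^ (4 * i + 4) = D₂ at *
  generalize 1 - q ^ (4 * i + 4) * q ^ (4 * N + 1) = D₃ at *
  rw [div_mul_eq_mul_div, div_eq_iff (by positivity)]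
  ring

lemma sixPhiFive_eval (hq : q ≠ 0) (hinj : Function.Injective fun m : ℕ => q ^ m) (N : ℕ) :
    (1 - q) * ∏ i ∈ range N,
        (1 - q * (q ^ 4) ^ (i + 1)) * (q ^ (4 * N + 2) * q - q * (q ^ 4) ^ (i + 1)) /
          ((q ^ (4 * N + 2) - q * (q ^ 4) ^ (i + 1)) * (q - q * (q ^ 4) ^ (i + 1))) =
      (1 - q ^ (4 * N + 1)) * qRatio q 2 N * (q ^ N)⁻¹ := by
  have hne (m : ℕ) : 1 - q ^ (m + 1) ≠ 0 := sub_ne_zero.2 fun h =>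
    absurd (@hinj 0 (m + 1) (by simpa using h)) (by omega)
  have e1 : (1 - q) * ∏ i ∈ range N, (1 - q * (q ^ 4) ^ (i + 1)) =
      (∏ i ∈ range N, (1 - q ^ (4 * i + 1))) * (1 - q ^ (4 * N + 1)) := by
    rw [← prod_range_succ (fun i => 1 - q ^ (4 * i + 1)), prod_range_succ', mul_comm]
    simp only [← pow_mul, ← pow_succ', mul_zero, zero_add, pow_one]
  have refl (e : ℕ) : ∏ i ∈ range N, (q ^ (4 * N + 1 + e) - q * (q ^ 4) ^ (i + 1)) =
      (∏ i ∈ range N, (-q ^ (4 * i + 5))) * ∏ i ∈ range N, (1 - q ^ (4 * i + e)) := by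
    rw [← prod_range_reflect (fun i => 1 - q ^ (4 * i + e)), ← prod_mul_distrib]
    refine prod_congr rfl fun i hi => ?_
    have hi := mem_range.1 hi
    rw [mul_sub, neg_mul, neg_mul, ← pow_add,
      show 4 * i + 5 + (4 * (N - 1 - i) + e) = 4 * N + 1 + e by omega]
    ring
  have e4 : ∏ i ∈ range N, (q - q * (q ^ 4) ^ (i + 1)) =
      q ^ N * ∏ i ∈ range N, (1 - q ^ (4 * i + 4)) := by
    conv_rhs => rw [← card_range N, ← prod_const, card_range, ← prod_mul_distrib]
    exact prod_congr rfl fun i _ => by ring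
  have n1 : ∏ i ∈ range N, (1 - q ^ (4 * i + 1)) ≠ 0 := prod_ne_zero_iff.2 fun i _ => hne _
  have n2 : ∏ i ∈ range N, (1 - q ^ (4 * i + 4)) ≠ 0 := prod_ne_zero_iff.2 fun i _ => hne _
  have n3 : ∏ i ∈ range N, (-q ^ (4 * i + 5)) ≠ 0 :=
    prod_ne_zero_iff.2 fun i _ => neg_ne_zero.2 (pow_ne_zero _ hq)
  have n4 : q ^ N ≠ 0 := pow_ne_zero _ hq
  have e2 := refl 2
  have e3 := refl 1
  rw [show q ^ (4 * N + 1 + 2) = q ^ (4 * N + 2) * q by ring] at e2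
  rw [show 4 * N + 1 + 1 = 4 * N + 2 by ring] at e3
  rw [prod_div_distrib, prod_mul_distrib, prod_mul_distrib, e2, e3, e4, ← mul_div_assoc,
    ← mul_assoc, e1, qRatio, prod_div_distrib]
  field_simp

/-- At `w = (1 - q ^ n) ^ 2` the deformed sum is a terminating `₆φ₅` and can be summed. -/
theorem deformedNum_eval (hq : q ≠ 0) (hinj : Function.Injective fun m : ℕ => q ^ m) (N : ℕ) :
    deformedNum (q ^ (4 * N + 1)) q ((1 - q ^ (4 * N + 1)) ^ 2) N =
      (1 - q ^ (4 * N + 1)) * qRatio q 2 N * (q ^ N)⁻¹ *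
        deformedDen (q ^ (4 * N + 1)) q ((1 - q ^ (4 * N + 1)) ^ 2) N := by
  have hsub {a b : ℕ} (h : a ≠ b) : q ^ a - q ^ b ≠ 0 := sub_ne_zero.2 fun h' => h (hinj h')
  rw [← sixPhiFive_eval hq hinj, ← sum_wellPoised, sum_mul]
  · refine sum_congr rfl fun k hk => ?_
    have hk : k ≤ N := by rw [mem_range] at hk; omega
    rw [deformedDen, ← prod_range_mul_prod_Ico _ hk]
    have := wellPoisedProd_eq_quadFactor hq hinj hk
    linear_combination (-(1 - q ^ (8 * k + 1)) * ∏ i ∈ Ico k N,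
      quadFactor (q ^ (4 * N + 1)) q ((1 - q ^ (4 * N + 1)) ^ 2) (4 * i + 4)) * this
  · exact pow_ne_zero _ hq
  · intro i
    rw [show 1 - (q ^ 4) ^ (i + 1) = q ^ 0 - q ^ (4 * i + 4) by ring]
    exact hsub (by omega)
  · intro i
    rw [show 1 - q * (q ^ 4) ^ (i + 1) = q ^ 0 - q ^ (4 * i + 5) by ring]
    exact hsub (by omega)
  · intro i
    rw [show q * (q ^ 4) ^ (i + 1) = q ^ (4 * i + 5) by ring]
    exact hsub (by omega)
  · intro i
    rw [show q - q * (q ^ 4) ^ (i + 1) = q ^ 1 - q ^ (4 * i + 5) by ring]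
    exact hsub (by omega)

end Evaluation

section Cyclotomic

variable {ζ : ℂ} {d : ℕ}

lemma cyclotomic_dvd_iff (hζ : IsPrimitiveRoot ζ d) (hd : 0 < d) (f : ℚ[X]) :
    cyclotomic d ℚ ∣ f ↔ aeval ζ f = 0 := by
  rw [cyclotomic_eq_minpoly_rat hζ hd, minpoly.dvd_iff]

lemma isCoprime_cyclotomic (hζ : IsPrimitiveRoot ζ d) (hd : 0 < d) {g : ℚ[X]}
    (hg : aeval ζ g ≠ 0) : IsCoprime (cyclotomic d ℚ) g :=
  (cyclotomic.irreducible_rat hd).coprime_iff_not_dvd.2 fun h =>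
    hg ((cyclotomic_dvd_iff hζ hd g).1 h)

lemma dvd_num_of_mul_eq {p f g : ℚ[X]} {x : RatFunc ℚ} (hg : IsCoprime p g) (hp : p ∣ f)
    (h : x * algebraMap ℚ[X] (RatFunc ℚ) g = algebraMap ℚ[X] (RatFunc ℚ) f) : p ∣ x.num := by
  have hden : algebraMap ℚ[X] (RatFunc ℚ) x.denom ≠ 0 := by
    rw [Ne, map_eq_zero_iff _ (RatFunc.algebraMap_injective ℚ)]
    exact RatFunc.denom_ne_zero x
  have key : x.num * g = f * x.denom := by
    apply RatFunc.algebraMap_injective ℚ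
    rw [map_mul, map_mul, ← h]
    nth_rw 2 [← RatFunc.num_div_denom x]
    field_simp
  exact hg.dvd_of_dvd_mul_right (key ▸ hp.mul_right _)

lemma ratCongr_of_dvd_num {M : ℚ[X]} {x : RatFunc ℚ} (h : M ∣ x.num) : ratCongr M x := by
  obtain ⟨f, hf⟩ := h
  refine ⟨f, x.denom, (RatFunc.isCoprime_num_denom x).of_isCoprime_of_dvd_left ⟨f, hf⟩, ?_⟩
  rw [← map_mul, ← hf]
  nth_rw 1 [← RatFunc.num_div_denom x]
  refine div_mul_cancel₀ _ ?_
  rw [Ne, map_eq_zero_iff _ (RatFunc.algebraMap_injective ℚ)]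
  exact RatFunc.denom_ne_zero x

lemma cyclotomic_dvd_num (hζ : IsPrimitiveRoot ζ d) (hd : 0 < d) {x : RatFunc ℚ}
    (hx : SpecializesTo ζ x 0) : cyclotomic d ℚ ∣ x.num := by
  obtain ⟨f, g, hg, h, hf⟩ := hx
  exact dvd_num_of_mul_eq (isCoprime_cyclotomic hζ hd hg)
    ((cyclotomic_dvd_iff hζ hd f).2 (by rw [hf, zero_mul])) h

/-- Every coefficient of the deformed numerator, as a polynomial in `w`, is divisible by `Φ_n`. -/
lemma exists_deformedNum_eq_cyclotomic_mul {N : ℕ} (hζ : IsPrimitiveRoot ζ (4 * N + 1)) :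
    ∃ P : ℚ[X][X], ∀ w : ℚ[X], deformedNum (X ^ (4 * N + 1)) X w N =
      cyclotomic (4 * N + 1) ℚ * P.eval w := by
  have hmap (φ : ℚ[X] →+* ℂ) (hφ : φ X = ζ) :
      (deformedNum (C (X ^ (4 * N + 1))) (C X) X N : ℚ[X][X]).map φ = 0 := by
    rw [← coe_mapRingHom, map_deformedNum, coe_mapRingHom, map_C, map_C, map_X, map_pow, hφ,
      hζ.pow_eq_one, C_1]
    refine self_eq_neg.1 (deformedNum_eq_neg ?_ _)
    rw [← C_pow, hζ.pow_eq_one, C_1]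
  obtain ⟨P, hP⟩ : C (cyclotomic (4 * N + 1) ℚ) ∣
      (deformedNum (C (X ^ (4 * N + 1))) (C X) X N : ℚ[X][X]) := by
    rw [C_dvd_iff_dvd_coeff]
    intro i
    rw [cyclotomic_dvd_iff hζ (by omega)]
    have := congrArg (fun f => f.coeff i) (hmap (aeval ζ : ℚ[X] →ₐ[ℚ] ℂ).toRingHom (aeval_X ζ))
    simp only [coeff_map, coeff_zero] at this
    exact this
  refine ⟨P, fun w => ?_⟩
  have := congrArg (evalRingHom w) hP
  rw [map_deformedNum] at this
  simpa using this

lemma cyclotomic_pow_three_dvd {N : ℕ} (hζ : IsPrimitiveRoot ζ (4 * N + 1)) {s w : ℚ[X]}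
    (hs : s = X ^ (4 * N + 1)) (hw : w = (1 - X ^ (4 * N + 1)) ^ 2) :
    cyclotomic (4 * N + 1) ℚ ^ 3 ∣
      deformedNum s X 0 N * deformedDen s X w N - deformedNum s X w N * deformedDen s X 0 N := by
  obtain ⟨P, hP⟩ := exists_deformedNum_eq_cyclotomic_mul hζ
  obtain ⟨D, hD⟩ : ∃ D : ℚ[X][X], ∀ w : ℚ[X], deformedDen s X w N = D.eval w :=
    ⟨deformedDen (C s) (C X) X N, fun w => by
      rw [← coe_evalRingHom, map_deformedDen]; simp⟩
  have hΦ : cyclotomic (4 * N + 1) ℚ ^ 2 ∣ w := by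
    rw [hw, sub_sq_comm]
    exact pow_dvd_pow_of_dvd (cyclotomic.dvd_X_pow_sub_one _ ℚ) 2
  have h1 : w ∣ P.eval w - P.eval 0 := by simpa using sub_dvd_eval_sub w 0 P
  have h2 : w ∣ D.eval w - D.eval 0 := by simpa using sub_dvd_eval_sub w 0 D
  rw [hs, hP, hP, ← hs, hD, hD, pow_succ',
    show cyclotomic (4 * N + 1) ℚ * P.eval 0 * D.eval w -
      cyclotomic (4 * N + 1) ℚ * P.eval w * D.eval 0 = cyclotomic (4 * N + 1) ℚ *
        (P.eval w * (D.eval w - D.eval 0) - (P.eval w - P.eval 0) * D.eval w) by ring]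
  exact mul_dvd_mul_left _ (hΦ.trans (dvd_sub (h2.mul_left _) (h1.mul_right _)))

lemma aeval_deformedDen_ne_zero {N : ℕ} (hζ : IsPrimitiveRoot ζ (4 * N + 1)) {w : ℚ[X]}
    (hw : aeval ζ w = 0) : aeval ζ (deformedDen (X ^ (4 * N + 1)) X w N) ≠ 0 := by
  have := map_deformedDen (aeval ζ : ℚ[X] →ₐ[ℚ] ℂ).toRingHom (X ^ (4 * N + 1)) X w N
  simp only [AlgHom.toRingHom_eq_coe, RingHom.coe_coe, map_pow, aeval_X, hw, hζ.pow_eq_one] at this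
  rw [this]
  refine prod_ne_zero_iff.2 fun i hi => ?_
  have := one_sub_pow_ne_zero hζ (not_dvd_four_mul (r := i)
    (Nat.Coprime.symm (by simp)) (by rw [mem_range] at hi; omega))
  simp [quadFactor, this]

end Cyclotomic

/-- The difference of the two sides of the congruence, for `n = 4 * N + 1`. -/
noncomputable def congrDiff (N : ℕ) : RatFunc ℚ :=
  (∑ k ∈ range (N + 1), summand RatFunc.X k) / (1 - RatFunc.X) -
    qRatio RatFunc.X 2 N * ((1 - RatFunc.X ^ (4 * N + 1)) / (1 - RatFunc.X)) *
      (RatFunc.X ^ N)⁻¹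

lemma ratFuncX_pow_injective : Function.Injective fun m : ℕ => (RatFunc.X : RatFunc ℚ) ^ m := by
  intro a b h
  wlog hab : a ≤ b generalizing a b
  · exact (this h.symm (by omega)).symm
  obtain ⟨c, rfl⟩ := Nat.exists_eq_add_of_le hab
  by_contra hc
  refine one_sub_ratFuncX_pow_ne_zero (m := c) (by omega) ?_
  have hX := pow_ne_zero a (RatFunc.X_ne_zero (K := ℚ))
  refine (mul_eq_zero.1 ?_).resolve_left hX
  simp only [pow_add] at h
  linear_combination h

theorem cyclotomic_pow_three_dvd_num_congrDiff {N : ℕ} (hN : 0 < N) :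
    cyclotomic (4 * N + 1) ℚ ^ 3 ∣ (congrDiff N).num := by
  have hζ := Complex.isPrimitiveRoot_exp (4 * N + 1) (by omega)
  generalize Complex.exp _ = ζ at hζ
  set s : ℚ[X] := X ^ (4 * N + 1) with hs
  set w : ℚ[X] := (1 - X ^ (4 * N + 1)) ^ 2 with hw
  have hw0 : aeval ζ w = 0 := by simp [hw, hζ.pow_eq_one]
  have h1ζ : 1 - ζ ≠ 0 := by
    simpa using one_sub_pow_ne_zero hζ (a := 1) (by rw [Nat.dvd_one]; omega)
  refine dvd_num_of_mul_eq (g := (1 - X) * (deformedDen s X 0 N * deformedDen s X w N))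
    (IsCoprime.pow_left (isCoprime_cyclotomic hζ (by omega) ?_))
    (cyclotomic_pow_three_dvd hζ hs hw) ?_
  · simp [h1ζ, aeval_deformedDen_ne_zero hζ hw0, aeval_deformedDen_ne_zero hζ (map_zero _), hs]
  · have hsum := sum_summand_eq (RatFunc.X : RatFunc ℚ) N
      (fun i _ => one_sub_ratFuncX_pow_ne_zero (by omega)) (RatFunc.X ^ (4 * N + 1))
    have heval := deformedNum_eval (RatFunc.X_ne_zero (K := ℚ)) ratFuncX_pow_injective N
    have h1X : (1 - RatFunc.X : RatFunc ℚ) ≠ 0 := by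
      simpa using one_sub_ratFuncX_pow_ne_zero one_ne_zero
    simp only [map_sub, map_mul, map_deformedNum, map_deformedDen, hs, hw, map_pow, map_one,
      RatFunc.algebraMap_X, map_zero, congrDiff]
    rw [heval, ← hsum]
    field_simp

theorem cyclotomic_dvd_num_congrDiff {N d : ℕ} (hd : d ∣ 4 * N + 1) (hd1 : d ≠ 1) :
    cyclotomic d ℚ ∣ (congrDiff N).num := by
  have hd0 : 0 < d := Nat.pos_of_dvd_of_pos hd (by omega)
  have hζ := Complex.isPrimitiveRoot_exp d hd0.ne'
  generalize Complex.exp _ = ζ at hζ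
  have hcop : d.Coprime 4 := Nat.Coprime.coprime_dvd_left hd (Nat.Coprime.symm (by simp))
  have h1ζ : 1 - ζ ≠ 0 := by
    simpa using one_sub_pow_ne_zero hζ (a := 1) (by rwa [Nat.dvd_one])
  have h1 : SpecializesTo ζ (1 - RatFunc.X) (1 - ζ) := (SpecializesTo.one ζ).sub (.X ζ)
  have hodd : d % 2 = 1 := by
    rw [← Nat.odd_iff]
    exact Odd.of_dvd_nat (by rw [Nat.odd_iff]; omega) hd
  obtain ⟨z, hz⟩ := exists_specializesTo_qRatio_mul_add hζ hcop (e := 2) (i₀ := (d - 1) / 2)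
    (by omega) ⟨2, by omega⟩ (N / d)
  have hq := hz (N % d) (Nat.mod_lt _ hd0)
  rw [Nat.div_add_mod] at hq
  have hn := SpecializesTo.one_sub_X_pow ζ (4 * N + 1)
  rw [(hζ.pow_eq_one_iff_dvd _).2 hd, sub_self] at hn
  refine cyclotomic_dvd_num hζ hd0 ?_
  have := ((specializesTo_sum_summand hζ hcop hd hd0).div h1 h1ζ).sub
    ((hq.mul (hn.div h1 h1ζ)).mul
      (((SpecializesTo.X ζ).pow N).inv (pow_ne_zero _ (hζ.ne_zero hd0.ne'))))
  simpa [congrDiff] using this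

theorem ratCongr_congrDiff (N : ℕ) :
    ratCongr ((∑ i ∈ range (4 * N + 1), (X : ℚ[X]) ^ i) * cyclotomic (4 * N + 1) ℚ ^ 2)
      (congrDiff N) := by
  apply ratCongr_of_dvd_num
  obtain rfl | hN := Nat.eq_zero_or_pos N
  · have : congrDiff 0 = 0 := by simp [congrDiff, summand, qRatio]
    simp [this]
  rw [← prod_cyclotomic_eq_geom_sum (by omega),
    ← prod_erase_mul _ _ (show 4 * N + 1 ∈ (4 * N + 1).divisors.erase 1 by simp; omega),
    mul_assoc, ← pow_succ']
  refine IsCoprime.mul_dvd ?_ ?_ (cyclotomic_pow_three_dvd_num_congrDiff hN)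
  · refine IsCoprime.pow_right (IsCoprime.prod_left fun d hd => ?_)
    exact cyclotomic.isCoprime_rat (ne_of_mem_erase hd)
  · refine prod_dvd_of_coprime (fun a _ b _ hab => cyclotomic.isCoprime_rat hab) fun d hd => ?_
    simp only [mem_erase, Nat.mem_divisors] at hd
    exact cyclotomic_dvd_num_congrDiff hd.2.2.1 hd.2.1

/-- First q-analogue of Van Hamme's (G.2), truncated at `(n-1)/4`
(Theorem 1, eq. (1.3) of the paper). -/
theorem stmt2 (n : ℕ) (hn : 0 < n) (hn4 : n % 4 = 1) :
    let q : RatFunc ℚ := RatFunc.X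
    ratCongr ((∑ i ∈ Finset.range n, (X : ℚ[X]) ^ i) * cyclotomic n ℚ ^ 2)
      ((∑ k ∈ Finset.range ((n - 1) / 4 + 1),
          qInt q (8 * (k : ℤ) + 1) * qPoch q (q ^ 4) k ^ 4 / qPoch (q ^ 4) (q ^ 4) k ^ 4 *
            q ^ (2 * k)) -
        qPoch (q ^ 2) (q ^ 4) ((n - 1) / 4) / qPoch (q ^ 4) (q ^ 4) ((n - 1) / 4) *
          qInt q (n : ℤ) * q ^ ((1 - (n : ℤ)) / 4)) := by
  intro q
  obtain ⟨N, rfl⟩ : ∃ N, n = 4 * N + 1 := ⟨n / 4, by omega⟩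
  have hN : (4 * N + 1 - 1) / 4 = N := by omega
  have hN' : (1 - ((4 * N + 1 : ℕ) : ℤ)) / 4 = -(N : ℤ) := by omega
  rw [hN, hN', zpow_neg, zpow_natCast, qPoch_div_qPoch]
  have h (k : ℕ) : qInt q (8 * (k : ℤ) + 1) * qPoch q (q ^ 4) k ^ 4 /
      qPoch (q ^ 4) (q ^ 4) k ^ 4 * q ^ (2 * k) = summand q k / (1 - q) := by
    rw [mul_div_assoc, ← div_pow, summand, ← qPoch_div_qPoch, pow_one, qInt,
      show 8 * (k : ℤ) + 1 = ((8 * k + 1 : ℕ) : ℤ) by push_cast; rfl, zpow_natCast]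
    ring
  simp only [h]
  rw [← sum_div, qInt, zpow_natCast]
  exact ratCongr_congrDiff N
end

section
/- Let p be a prime with p ≡ 1 (mod 4). Then the sum over k from 0 to (p−1)/4 of (8k+1) · ((1/4)_k / k!)^4 is congruent to p · (1/2)_{(p−1)/4} / (1)_{(p−1)/4} modulo p^3, where the congruence is between p-adic rational numbers (both sides are p-integral). -/
open Polynomial Finset

/-- `x ≡ 0 (mod p^r)` for a rational number `x`: `x = p^r·(a/b)` with `b` prime to `p`,
i.e. the `p`-adic valuation of `x` is at least `r` (or `x = 0`). -/
def padicCongr (p r : ℕ) (x : ℚ) : Prop :=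
  ∃ a b : ℤ, ¬ (p : ℤ) ∣ b ∧ x * b = (p : ℚ) ^ r * a

section Products

variable {R S : Type*} [CommRing R] [CommRing S]

/-- The product of `(4j+1)² - w` over `0 ≤ j < k`. -/
def oddProd (w : R) (k : ℕ) : R := ∏ j ∈ range k, ((4 * (j : R) + 1) ^ 2 - w)

/-- The product of `(4j)² - w` over `1 ≤ j ≤ k`. -/
def evenProd (w : R) (k : ℕ) : R := ∏ j ∈ range k, ((4 * (j : R) + 4) ^ 2 - w)

/-- The product of `(4j)² - w` over `k < j ≤ n`. -/
def evenTail (w : R) (n k : ℕ) : R := ∏ j ∈ range (n - k), ((4 * ((n : R) - (j : R))) ^ 2 - w)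

/-- The numerator of `∑ₖ (8k+1) oddProd 0 k * oddProd w k / (evenProd 0 k * evenProd w k)` over the
common denominator `evenProd 0 n * evenProd w n`. -/
def numer (w : R) (n : ℕ) : R :=
  ∑ k ∈ range (n + 1),
    (8 * (k : R) + 1) * (oddProd 0 k * evenTail 0 n k * (oddProd w k * evenTail w n k))

lemma map_numer (f : R →+* S) (w : R) (n : ℕ) : f (numer w n) = numer (f w) n := by
  simp [numer, oddProd, evenTail, map_sum, map_prod, map_ofNat]

lemma map_evenProd (f : R →+* S) (w : R) (n : ℕ) : f (evenProd w n) = evenProd (f w) n := by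
  simp [evenProd, map_prod, map_ofNat]

lemma evenProd_mul_evenTail (w : R) {n k : ℕ} (h : k ≤ n) :
    evenProd w k * evenTail w n k = evenProd w n := by
  obtain ⟨m, rfl⟩ := Nat.exists_eq_add_of_le h
  rw [evenProd, evenProd, prod_range_add, evenTail, Nat.add_sub_cancel_left,
    ← prod_range_reflect _ m]
  congr 1
  refine prod_congr rfl fun j hj => ?_
  have hj' := mem_range.1 hj
  have : ((m - 1 - j : ℕ) : R) = m - 1 - j := by
    rw [Nat.cast_sub (by omega), Nat.cast_sub (by omega), Nat.cast_one]
  rw [this]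
  push_cast
  ring

lemma evenTail_eq_oddProd (w : R) {n : ℕ} (k : ℕ) (h : 4 * (n : R) + 1 = 0) :
    evenTail w n k = oddProd w (n - k) := by
  refine prod_congr rfl fun j _ => ?_
  linear_combination (4 * (n : R) - 8 * (j : R) - 1) * h

lemma two_mul_numer_eq_zero (w : R) {n : ℕ} (h : 4 * (n : R) + 1 = 0) : 2 * numer w n = 0 := by
  have hodd : numer w n = ∑ k ∈ range (n + 1),
      (8 * (k : R) + 1) * (oddProd 0 k * oddProd 0 (n - k) * (oddProd w k * oddProd w (n - k))) :=
    sum_congr rfl fun k _ => by rw [evenTail_eq_oddProd _ _ h, evenTail_eq_oddProd _ _ h]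
  rw [two_mul]
  nth_rewrite 1 [hodd]
  rw [← sum_range_reflect, hodd, ← sum_add_distrib]
  refine sum_eq_zero fun k hk => ?_
  have hk' : k ≤ n := Nat.lt_succ_iff.1 (mem_range.1 hk)
  rw [show n + 1 - 1 - k = n - k by omega, Nat.sub_sub_self hk', Nat.cast_sub hk']
  linear_combination (2 * (oddProd 0 k * oddProd 0 (n - k) * (oddProd w k * oddProd w (n - k)))) * h

end Products

lemma C_dvd_numer_X {p n : ℕ} (hp : p.Prime) (hpn : p = 4 * n + 1) :
    C (p : ℤ) ∣ numer (X : ℤ[X]) n := by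
  have : Fact p.Prime := ⟨hp⟩
  have hzero : mapRingHom (Int.castRingHom (ZMod p)) (numer (X : ℤ[X]) n) = 0 := by
    rw [map_numer]
    have h4 : 4 * (n : (ZMod p)[X]) + 1 = 0 := by
      have : ((4 * n + 1 : ℕ) : (ZMod p)[X]) = 0 := by
        rw [← hpn, ← map_natCast C, CharP.cast_eq_zero, map_zero]
      exact_mod_cast this
    have h2 : (2 : (ZMod p)[X]) ≠ 0 := by
      intro h
      have h' : ((2 : ℕ) : ZMod p) = 0 := by
        apply C_injective
        rwa [map_natCast, map_zero]
      have := Nat.le_of_dvd two_pos ((ZMod.natCast_eq_zero_iff _ _).1 h')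
      have := hp.two_le
      omega
    exact (mul_eq_zero.1 (two_mul_numer_eq_zero _ h4)).resolve_left h2
  rw [C_dvd_iff_dvd_coeff]
  intro i
  rw [← ZMod.intCast_zmod_eq_zero_iff_dvd]
  simpa using congrArg (fun q => coeff q i) hzero

lemma cube_dvd_numer_sub {p n : ℕ} (hp : p.Prime) (hpn : p = 4 * n + 1) :
    (p : ℤ) ∣ numer ((p : ℤ) ^ 2) n ∧
      (p : ℤ) ^ 3 ∣ numer (0 : ℤ) n - numer ((p : ℤ) ^ 2) n := by
  obtain ⟨M, hM⟩ := C_dvd_numer_X hp hpn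
  have heval (z : ℤ) : numer z n = p * M.eval z := by
    have := map_numer (evalRingHom z) (X : ℤ[X]) n
    rw [hM] at this
    simpa using this.symm
  obtain ⟨c, hc⟩ := M.sub_dvd_eval_sub 0 ((p : ℤ) ^ 2)
  exact ⟨⟨_, heval _⟩, ⟨-c, by rw [heval, heval]; linear_combination (p : ℤ) * hc⟩⟩

lemma sq_dvd_evenProd_sub (p : ℤ) (n : ℕ) : p ^ 2 ∣ evenProd 0 n - evenProd (p ^ 2) n := by
  have h := (evenProd (X : ℤ[X]) n).sub_dvd_eval_sub 0 (p ^ 2)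
  have heval (z : ℤ) : (evenProd (X : ℤ[X]) n).eval z = evenProd z n := by
    simpa using map_evenProd (evalRingHom z) (X : ℤ[X]) n
  rw [heval, heval] at h
  simpa using h

lemma not_dvd_evenProd_zero {p n : ℕ} (hp : p.Prime) (hpn : p = 4 * n + 1) :
    ¬ (p : ℤ) ∣ evenProd 0 n := by
  rw [evenProd, (Nat.prime_iff_prime_int.1 hp).dvd_finsetProd_iff]
  rintro ⟨j, hj, h⟩
  rw [sub_zero] at h
  have h' := (Nat.prime_iff_prime_int.1 hp).dvd_of_dvd_pow h
  have := Nat.le_of_dvd (by omega) (show p ∣ 4 * j + 4 by exact_mod_cast h')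
  have := mem_range.1 hj
  omega

/-- The summand of the terminating well-poised series, without its linear factor `8k+1`. -/
def wellPoisedTerm (n k : ℕ) : ℚ :=
  oddProd 0 k * oddProd ((4 * (n : ℚ) + 1) ^ 2) k /
    (evenProd 0 k * evenProd ((4 * (n : ℚ) + 1) ^ 2) k)

lemma four_mul_add_three_sub_ne_zero (n k : ℕ) : 4 * (k : ℚ) + 3 - 4 * n ≠ 0 := by
  have : 4 * (k : ℤ) + 3 - 4 * n ≠ 0 := by omega
  exact_mod_cast this

lemma wellPoisedTerm_zero (n : ℕ) : wellPoisedTerm n 0 = 1 := by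
  simp [wellPoisedTerm, oddProd, evenProd]

lemma wellPoisedTerm_succ (n k : ℕ) :
    wellPoisedTerm n (k + 1) = wellPoisedTerm n k *
      ((4 * k + 1) ^ 2 * ((4 * k - 4 * n) * (4 * k + 4 * n + 2)) /
        ((4 * k + 4) ^ 2 * ((4 * k + 3 - 4 * n) * (4 * k + 4 * n + 5)))) := by
  simp only [wellPoisedTerm, oddProd, evenProd, prod_range_succ]
  rw [div_mul_div_comm]
  congr 1 <;> ring

lemma wellPoisedTerm_succ_succ (n k : ℕ) :
    wellPoisedTerm (n + 1) (k + 1) = wellPoisedTerm n k *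
      ((4 * k + 1) ^ 2 * (n + 1) * (2 * n + 1 + 2 * k) * (2 * n + 3 + 2 * k) * (4 * n + 5) * 2 /
        ((k + 1) ^ 2 * (2 * n + 1) * (4 * n + 5 + 4 * k) * (4 * n + 9 + 4 * k) * (4 * n + 1) * 4)) := by
  induction k with
  | zero =>
    rw [wellPoisedTerm_succ, wellPoisedTerm_zero, wellPoisedTerm_zero]
    have h1 : 4 * ((0 : ℕ) : ℚ) + 3 - 4 * ((n + 1 : ℕ) : ℚ) ≠ 0 :=
      four_mul_add_three_sub_ne_zero (n + 1) 0
    push_cast at h1 ⊢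
    field_simp
    ring
  | succ k ih =>
    rw [wellPoisedTerm_succ (n + 1), ih, wellPoisedTerm_succ n]
    have h1 := four_mul_add_three_sub_ne_zero n k
    have h2 := four_mul_add_three_sub_ne_zero (n + 1) (k + 1)
    have h3 : 4 * ((k + 1 : ℕ) : ℚ) + 3 - 4 * ((n + 1 : ℕ) : ℚ) = 4 * k + 3 - 4 * n := by
      push_cast; ring
    rw [h3]
    push_cast
    field_simp
    ring

/-- The quotient of consecutive values of the terminating well-poised sum. -/
def wellPoisedRatio (n : ℕ) : ℚ := (4 * n + 5) * (2 * n + 1) / ((4 * n + 1) * (2 * n + 2))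

lemma sum_wellPoisedTerm_sub (n m : ℕ) :
    ∑ k ∈ range (m + 1), ((8 * (k : ℚ) + 1) * wellPoisedTerm (n + 1) k -
        wellPoisedRatio n * ((8 * (k : ℚ) + 1) * wellPoisedTerm n k)) =
      -wellPoisedRatio n * ((4 * n + 3) * (4 * m + 1) ^ 2 * (2 * m + 2 * n + 1) /
        ((2 * n + 1) ^ 2 * (4 * m + 4 * n + 5))) * wellPoisedTerm n m := by
  induction m with
  | zero =>
    simp only [zero_add, sum_range_one, wellPoisedTerm_zero, wellPoisedRatio]
    push_cast
    field_simp
    ring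
  | succ m ih =>
    rw [sum_range_succ, ih, wellPoisedTerm_succ_succ, wellPoisedTerm_succ n m, wellPoisedRatio]
    have h1 := four_mul_add_three_sub_ne_zero n m
    push_cast
    field_simp
    ring

lemma sum_wellPoisedTerm (n : ℕ) :
    ∑ k ∈ range (n + 1), (8 * (k : ℚ) + 1) * wellPoisedTerm n k =
      (4 * n + 1) * (ascPochhammer ℚ n).eval (1 / 2 : ℚ) / (ascPochhammer ℚ n).eval (1 : ℚ) := by
  induction n with
  | zero => simp [wellPoisedTerm_zero]
  | succ n ih =>
    have hz : wellPoisedTerm n (n + 1) = 0 := by simp [wellPoisedTerm_succ]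
    have h := sum_wellPoisedTerm_sub n (n + 1)
    rw [hz, mul_zero, sum_sub_distrib, ← mul_sum, sum_range_succ (fun k : ℕ =>
      (8 * (k : ℚ) + 1) * wellPoisedTerm n k) (n + 1), hz, mul_zero, add_zero, ih, sub_eq_zero] at h
    rw [h, ascPochhammer_succ_eval, ascPochhammer_succ_eval, wellPoisedRatio]
    have h1 : (ascPochhammer ℚ n).eval 1 ≠ 0 := (ascPochhammer_pos n 1 one_pos).ne'
    push_cast
    field_simp
    ring

lemma sum_div_eq_numer_div (w : ℚ) (n : ℕ) (h0 : evenProd (0 : ℚ) n ≠ 0) (hw : evenProd w n ≠ 0) :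
    ∑ k ∈ range (n + 1),
        (8 * (k : ℚ) + 1) * (oddProd 0 k * oddProd w k / (evenProd 0 k * evenProd w k)) =
      numer w n / (evenProd 0 n * evenProd w n) := by
  rw [numer, sum_div]
  refine sum_congr rfl fun k hk => ?_
  have hk' : k ≤ n := Nat.lt_succ_iff.1 (mem_range.1 hk)
  rw [← evenProd_mul_evenTail _ hk'] at h0 hw ⊢
  rw [← evenProd_mul_evenTail w hk']
  have := left_ne_zero_of_mul h0
  have := right_ne_zero_of_mul h0
  have := left_ne_zero_of_mul hw
  have := right_ne_zero_of_mul hw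
  field_simp

lemma ascPochhammer_div_factorial_sq (k : ℕ) :
    ((ascPochhammer ℚ k).eval (1 / 4 : ℚ) / (k.factorial : ℚ)) ^ 2 =
      oddProd 0 k / evenProd 0 k := by
  induction k with
  | zero => simp [oddProd, evenProd]
  | succ k ih =>
    rw [oddProd, evenProd, prod_range_succ, prod_range_succ, mul_div_mul_comm, ← oddProd,
      ← evenProd, ← ih, ascPochhammer_succ_eval, Nat.factorial_succ]
    push_cast
    field_simp
    ring

/-- The `q → 1` form (1.5) of the first q-analogue of Van Hamme's (G.2):
`∑_{k=0}^{(p-1)/4} (8k+1) ((1/4)_k / k!)^4 ≡ p (1/2)_{(p-1)/4} / (1)_{(p-1)/4} (mod p³)`. -/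
theorem stmt4 (p : ℕ) (hp : p.Prime) (hp4 : p % 4 = 1) :
    padicCongr p 3
      ((∑ k ∈ Finset.range ((p - 1) / 4 + 1),
          (8 * (k : ℚ) + 1) * ((ascPochhammer ℚ k).eval (1 / 4 : ℚ) / (k.factorial : ℚ)) ^ 4) -
        (p : ℚ) * (ascPochhammer ℚ ((p - 1) / 4)).eval (1 / 2 : ℚ) /
          (ascPochhammer ℚ ((p - 1) / 4)).eval (1 : ℚ)) := by
  obtain ⟨n, hn⟩ : ∃ n, (p - 1) / 4 = n := ⟨_, rfl⟩
  have hpn : p = 4 * n + 1 := by omega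
  rw [hn]
  have hprime := Nat.prime_iff_prime_int.1 hp
  have hD0 := not_dvd_evenProd_zero hp hpn
  obtain ⟨d, hd⟩ := sq_dvd_evenProd_sub p n
  have hDp : ¬ (p : ℤ) ∣ evenProd ((p : ℤ) ^ 2) n := fun h => hD0 <| by
    rw [← dvd_sub_left h, hd]
    exact Dvd.intro _ (by ring : (p : ℤ) * (p * d) = _)
  obtain ⟨⟨b, hb⟩, ⟨a, ha⟩⟩ := cube_dvd_numer_sub hp hpn
  have cast_evenProd (z : ℤ) : ((evenProd z n : ℤ) : ℚ) = evenProd (z : ℚ) n :=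
    map_evenProd (Int.castRingHom ℚ) z n
  have cast_numer (z : ℤ) : ((numer z n : ℤ) : ℚ) = numer (z : ℚ) n :=
    map_numer (Int.castRingHom ℚ) z n
  have hq0 : ((evenProd (0 : ℤ) n : ℤ) : ℚ) ≠ 0 :=
    Int.cast_ne_zero.2 fun h => hD0 (by rw [h]; exact dvd_zero _)
  have hqp : ((evenProd ((p : ℤ) ^ 2) n : ℤ) : ℚ) ≠ 0 :=
    Int.cast_ne_zero.2 fun h => hDp (by rw [h]; exact dvd_zero _)
  have hsum0 : ∑ k ∈ range (n + 1), (8 * (k : ℚ) + 1) *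
      ((ascPochhammer ℚ k).eval (1 / 4 : ℚ) / (k.factorial : ℚ)) ^ 4 =
      ((numer (0 : ℤ) n : ℤ) : ℚ) / ((evenProd (0 : ℤ) n : ℤ) * (evenProd (0 : ℤ) n : ℤ)) := by
    rw [cast_evenProd, Int.cast_zero] at hq0
    rw [cast_evenProd, cast_numer, Int.cast_zero, ← sum_div_eq_numer_div 0 n hq0 hq0]
    refine sum_congr rfl fun k _ => ?_
    rw [pow_mul _ 2 2, ascPochhammer_div_factorial_sq, sq, div_mul_div_comm]
  have hsump : (p : ℚ) * (ascPochhammer ℚ n).eval (1 / 2 : ℚ) / (ascPochhammer ℚ n).eval (1 : ℚ) =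
      ((numer ((p : ℤ) ^ 2) n : ℤ) : ℚ) /
        ((evenProd (0 : ℤ) n : ℤ) * (evenProd ((p : ℤ) ^ 2) n : ℤ)) := by
    rw [cast_evenProd] at hq0 hqp
    rw [cast_evenProd, cast_evenProd, cast_numer]
    push_cast at hq0 hqp ⊢
    rw [← sum_div_eq_numer_div _ n hq0 hqp]
    have hpq : (p : ℚ) = 4 * n + 1 := by rw [hpn]; push_cast; ring
    rw [hpq, ← sum_wellPoisedTerm]
    rfl
  rw [hsum0, hsump]
  refine ⟨a * evenProd ((p : ℤ) ^ 2) n - b * d,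
    evenProd 0 n * evenProd 0 n * evenProd ((p : ℤ) ^ 2) n, ?_, ?_⟩
  · exact fun h => (hprime.dvd_or_dvd h).elim
      (fun h => (hprime.dvd_or_dvd h).elim hD0 hD0) hDp
  · have key : numer (0 : ℤ) n * evenProd ((p : ℤ) ^ 2) n -
        numer ((p : ℤ) ^ 2) n * evenProd 0 n =
        (p : ℤ) ^ 3 * (a * evenProd ((p : ℤ) ^ 2) n - b * d) := by
      linear_combination evenProd ((p : ℤ) ^ 2) n * ha - numer ((p : ℤ) ^ 2) n * hd -
        (p : ℤ) ^ 2 * d * hb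
    have keyq := congrArg (Int.cast : ℤ → ℚ) key
    rw [Int.cast_sub, Int.cast_mul, Int.cast_mul, Int.cast_mul _ (a * _ - _), Int.cast_pow,
      Int.cast_natCast] at keyq
    rw [← keyq, Int.cast_mul, Int.cast_mul]
    field_simp
end

section
/- Let n be a positive integer with n ≡ 1 (mod 4) and let a be an indeterminate. Then the sum over k from 0 to (n−1)/4 of [8k+1] · (q;q^4)_k^2 (aq;q^4)_k (q/a;q^4)_k / ((q^4;q^4)_k^2 (aq^4;q^4)_k (q^4/a;q^4)_k) · q^{2k} is congruent to ((q^2;q^4)_{(n−1)/4} / (q^4;q^4)_{(n−1)/4}) · [n] · q^{(1−n)/4} modulo [n]·(1−aq^n)·(a−q^n), as rational functions in a and q. -/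
open Polynomial Finset

/-- The rational function `x ∈ ℚ(a)(q)` is ≡ 0 modulo the polynomial `M ∈ ℚ(a)[q]`:
its numerator in lowest terms is divisible by `M`, i.e. `x = M·f/g` with `g` coprime to `M`.
Here the coefficient field `RatFunc ℚ` is the field of rational functions in `a`. -/
def ratCongr2 (M : Polynomial (RatFunc ℚ)) (x : RatFunc (RatFunc ℚ)) : Prop :=
  ∃ f g : Polynomial (RatFunc ℚ), IsCoprime M g ∧
    x * algebraMap (Polynomial (RatFunc ℚ)) (RatFunc (RatFunc ℚ)) g =
      algebraMap (Polynomial (RatFunc ℚ)) (RatFunc (RatFunc ℚ)) M *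
        algebraMap (Polynomial (RatFunc ℚ)) (RatFunc (RatFunc ℚ)) f

section Pochhammer

variable {L : Type*} [Field L]

lemma qPoch_zero (x r : L) : qPoch x r 0 = 1 := by simp [qPoch]

lemma qPoch_succ (x r : L) (k : ℕ) : qPoch x r (k + 1) = qPoch x r k * (1 - x * r ^ k) := by
  simp [qPoch, Finset.prod_range_succ]

lemma qPoch_succ' (x r : L) (k : ℕ) :
    qPoch x r (k + 1) = (1 - x) * qPoch (x * r) r k := by
  simp [qPoch, Finset.prod_range_succ', pow_succ', mul_assoc, mul_comm]

lemma qPoch_add (x r : L) (k l : ℕ) :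
    qPoch x r (k + l) = qPoch x r k * qPoch (x * r ^ k) r l := by
  simp [qPoch, Finset.prod_range_add, pow_add, mul_assoc]

lemma qPoch_ne_zero {x r : L} {k : ℕ} : qPoch x r k ≠ 0 ↔ ∀ i < k, x * r ^ i ≠ 1 := by
  rw [qPoch, Finset.prod_ne_zero_iff]
  simp only [Finset.mem_range, sub_ne_zero, ne_comm (a := (1 : L))]

lemma qPoch_inv_pow_eq_zero {p : L} (hp : p ≠ 0) {k j : ℕ} (h : k < j) :
    qPoch (p ^ k)⁻¹ p j = 0 := by
  rw [qPoch, Finset.prod_eq_zero (Finset.mem_range.2 h)]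
  rw [inv_mul_cancel₀ (pow_ne_zero _ hp), sub_self]

/-- Reversal of a `q`-shifted factorial. -/
lemma qPoch_reverse {x y p : L} {m : ℕ} (h : x * y * p ^ m = p) (hp : p ≠ 0) :
    qPoch x p m * (y ^ m * (∏ i ∈ range m, p ^ i) * (-1) ^ m) = qPoch y p m := by
  have hc : ∀ z : L, z ^ m = ∏ _i ∈ range m, z := fun z => by simp
  rw [hc y, hc (-1), qPoch, qPoch, ← Finset.prod_range_reflect, ← Finset.prod_mul_distrib,
    ← Finset.prod_mul_distrib, ← Finset.prod_mul_distrib]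
  refine Finset.prod_congr rfl fun i hi => ?_
  have hi := Finset.mem_range.1 hi
  have : x * p ^ (m - 1 - i) * (y * p ^ i) = 1 := by
    apply mul_right_cancel₀ hp
    have hm : p ^ m = p ^ (m - 1 - i) * p ^ i * p := by
      rw [← pow_add, ← pow_succ]
      congr 1
      omega
    rw [one_mul]
    conv_rhs => rw [← h, hm]
    ring
  linear_combination this

/-- Partial sums of the contiguous relation behind the `q`-Saalschütz summation. -/
lemma saalschutz_contiguous {p b c e x y : L} (hp : p ≠ 0) (hx : x ≠ 0)
    (hxy : x * y * p ^ 2 = b * c * e)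
    (h1 : ∀ j, qPoch p p j ≠ 0) (h2 : ∀ j, qPoch (c * e) p j ≠ 0)
    (h3 : ∀ j, qPoch (b * e) p j ≠ 0) (J : ℕ) :
    ∑ j ∈ range (J + 1), ((x * p - c * e) * (x * p - b * e) * (qPoch x p j * qPoch (y * p) p j) -
        e * (x * p - b) * (x * p - c) * (qPoch (x * p) p j * qPoch y p j)) *
        (qPoch e p j * p ^ j / (qPoch p p j * qPoch (c * e) p j * qPoch (b * e) p j)) =
      ((x * p) ^ 2 - b * c * e) * (qPoch (x * p) p J * qPoch (y * p) p J * qPoch e p (J + 1)) /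
        (qPoch p p J * qPoch (c * e) p J * qPoch (b * e) p J) := by
  induction J with
  | zero => simp [qPoch_zero, qPoch_succ]; ring
  | succ J ih =>
    rw [Finset.sum_range_succ, ih, qPoch_succ' x, qPoch_succ' y]
    have a1 := h1 (J + 1)
    have a2 := h2 (J + 1)
    have a3 := h3 (J + 1)
    rw [qPoch_succ] at a1 a2 a3
    obtain ⟨b1, c1⟩ := mul_ne_zero_iff.1 a1
    obtain ⟨b2, c2⟩ := mul_ne_zero_iff.1 a2
    obtain ⟨b3, c3⟩ := mul_ne_zero_iff.1 a3
    have hy : y = b * c * e / (x * p ^ 2) := by rw [← hxy]; field_simp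
    rw [qPoch_succ e p (J + 1)]
    simp only [qPoch_succ _ _ J]
    generalize qPoch (x * p) p J = X1
    generalize qPoch (y * p) p J = Y1
    generalize qPoch e p J = E1 at *
    generalize qPoch p p J = P at *
    generalize qPoch (c * e) p J = Q at *
    generalize qPoch (b * e) p J = R at *
    rw [hy]
    field_simp
    ring

/-- The `q`-Saalschütz summation. -/
lemma saalschutz {p b c e A : L} (hp : p ≠ 0) (hA : A * p = b * c * e)
    (h1 : ∀ j, qPoch p p j ≠ 0) (h2 : ∀ j, qPoch (c * e) p j ≠ 0)
    (h3 : ∀ j, qPoch (b * e) p j ≠ 0) (k N : ℕ) (hk : k ≤ N) :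
    ∑ j ∈ range (N + 1), qPoch (p ^ k)⁻¹ p j * qPoch (A * p ^ k) p j *
        (qPoch e p j * p ^ j / (qPoch p p j * qPoch (c * e) p j * qPoch (b * e) p j)) =
      qPoch b p k * qPoch c p k * e ^ k / (qPoch (c * e) p k * qPoch (b * e) p k) := by
  induction k with
  | zero =>
    rw [Finset.sum_range_succ', Finset.sum_eq_zero]
    · simp [qPoch_zero]
    · intro j _
      rw [qPoch_succ']
      simp
  | succ k ih =>
    have ih := ih (by omega)
    have hpk : p ^ k ≠ 0 := pow_ne_zero _ hp
    have hx : (p ^ (k + 1))⁻¹ * p = (p ^ k)⁻¹ := by rw [pow_succ]; field_simp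
    have key := saalschutz_contiguous (x := (p ^ (k + 1))⁻¹) (y := A * p ^ k) hp
      (by positivity) (by rw [← hA, pow_succ]; field_simp) h1 h2 h3 N
    rw [hx, qPoch_inv_pow_eq_zero hp (show k < N by omega)] at key
    simp_rw [sub_mul _ (_ * (_ * _)) (_ / _), mul_assoc _ (_ * _) (_ / _)] at key
    rw [Finset.sum_sub_distrib, ← Finset.mul_sum, ← Finset.mul_sum, ih, zero_mul,
      zero_mul, mul_zero, zero_div, sub_eq_zero] at key
    have a2 := h2 (k + 1)
    have a3 := h3 (k + 1)
    rw [qPoch_succ] at a2 a3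
    obtain ⟨b2, c2⟩ := mul_ne_zero_iff.1 a2
    obtain ⟨b3, c3⟩ := mul_ne_zero_iff.1 a3
    simp only [qPoch_succ _ _ k]
    rw [pow_succ p k, ← mul_assoc A, ← pow_succ]
    rw [eq_div_iff (by simp [*])]
    have h4 : ((p ^ k)⁻¹ - c * e) * ((p ^ k)⁻¹ - b * e) =
        (1 - c * e * p ^ k) * (1 - b * e * p ^ k) / (p ^ k) ^ 2 := by field_simp
    rw [h4] at key
    generalize ∑ j ∈ range (N + 1), (_ : L) = T at key ⊢
    generalize qPoch (c * e) p k = Q at *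
    generalize qPoch (b * e) p k = R at *
    field_simp at key ⊢
    linear_combination key

/-- Indefinite summation of the inner sum in Watson's transformation. -/
lemma wellPoised_inner_sum {p A d g : L} (hp : p ≠ 0) (hd : d ≠ 0) (hg : g * d = A * p)
    (h1 : ∀ j, qPoch p p j ≠ 0) (h2 : ∀ j, qPoch g p j ≠ 0) (j m : ℕ) :
    (1 - d * p ^ j) * ∑ k ∈ range (m + 1), (1 - A * p ^ (2 * k)) * (qPoch A p k * qPoch d p k) /
        (qPoch p p k * qPoch g p k * d ^ k) * (qPoch (p ^ k)⁻¹ p j * qPoch (A * p ^ k) p j) =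
      (1 - d) * (qPoch A p (m + 1) * qPoch (d * p) p m) /
        (qPoch p p m * qPoch g p m * d ^ m) *
        (qPoch (p ^ m)⁻¹ p j * qPoch (A * p ^ (m + 1)) p j) := by
  induction m with
  | zero =>
    cases j with
    | zero => simp [qPoch_zero, qPoch_succ]
    | succ j => simp [qPoch_succ']
  | succ m ih =>
    rw [Finset.sum_range_succ, mul_add, ih]
    have hpm : p ^ m ≠ 0 := pow_ne_zero _ hp
    have a1 := h1 (m + 1)
    have a2 := h2 (m + 1)
    rw [qPoch_succ] at a1 a2
    obtain ⟨b1, c1⟩ := mul_ne_zero_iff.1 a1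
    obtain ⟨b2, c2⟩ := mul_ne_zero_iff.1 a2
    have hx : (p ^ (m + 1))⁻¹ * p = (p ^ m)⁻¹ := by rw [pow_succ]; field_simp
    have hd1 : qPoch d p (m + 1) = (1 - d) * qPoch (d * p) p m := qPoch_succ' ..
    have hA : A = g * d / p := by rw [hg]; field_simp
    rw [hd1, qPoch_succ A p (m + 1), qPoch_succ (d * p) p m]
    cases j with
    | zero =>
      simp only [qPoch_zero]
      rw [qPoch_succ p p m, qPoch_succ g p m]
      generalize qPoch A p (m + 1) = U
      generalize qPoch (d * p) p m = V
      generalize qPoch p p m = P at *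
      generalize qPoch g p m = G at *
      subst hA
      field_simp
      ring
    | succ j =>
      rw [qPoch_succ' (p ^ (m + 1))⁻¹, hx, qPoch_succ (p ^ m)⁻¹ p j, qPoch_succ p p m,
        qPoch_succ g p m, qPoch_succ' (A * p ^ (m + 1)),
        qPoch_succ (A * p ^ (m + 1 + 1)), show A * p ^ (m + 1) * p = A * p ^ (m + 1 + 1) by ring]
      generalize qPoch A p (m + 1) = U
      generalize qPoch (d * p) p m = V
      generalize qPoch p p m = P at *
      generalize qPoch g p m = G at *
      generalize qPoch (p ^ m)⁻¹ p j = X1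
      generalize qPoch (A * p ^ (m + 1 + 1)) p j = Y1
      subst hA
      simp only [mul_add, two_mul, pow_add, pow_one]
      generalize p ^ m = z at c1 c2 hpm ⊢
      rw [mul_comm z p]
      generalize hs : 1 - p * z = s at c1 ⊢
      generalize ht : 1 - g * z = t at c2 ⊢
      field_simp
      subst hs ht
      ring

/-- A truncated very-well-poised `₆φ₅` series as a double sum. -/
lemma wellPoised_sum_eq {p b c e A d g : L} (hp : p ≠ 0) (hA : A * p = b * c * e)
    (h1 : ∀ j, qPoch p p j ≠ 0) (h2 : ∀ j, qPoch (c * e) p j ≠ 0)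
    (h3 : ∀ j, qPoch (b * e) p j ≠ 0) (m : ℕ) :
    ∑ k ∈ range (m + 1), (1 - A * p ^ (2 * k)) *
        (qPoch A p k * qPoch b p k * qPoch c p k * qPoch d p k) /
        (qPoch p p k * qPoch (c * e) p k * qPoch (b * e) p k * qPoch g p k) * (e / d) ^ k =
      ∑ j ∈ range (m + 1),
        qPoch e p j * p ^ j / (qPoch p p j * qPoch (c * e) p j * qPoch (b * e) p j) *
        ∑ k ∈ range (m + 1), (1 - A * p ^ (2 * k)) * (qPoch A p k * qPoch d p k) /
          (qPoch p p k * qPoch g p k * d ^ k) *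
          (qPoch (p ^ k)⁻¹ p j * qPoch (A * p ^ k) p j) := by
  simp only [Finset.mul_sum]
  rw [Finset.sum_comm]
  refine Finset.sum_congr rfl fun k hk => ?_
  have := saalschutz hp hA h1 h2 h3 k m (by simpa [Nat.lt_succ_iff] using hk)
  calc _ = (1 - A * p ^ (2 * k)) * (qPoch A p k * qPoch d p k) /
          (qPoch p p k * qPoch g p k * d ^ k) * (qPoch b p k * qPoch c p k * e ^ k /
            (qPoch (c * e) p k * qPoch (b * e) p k)) := by
        rw [div_pow, div_mul_div_comm, div_mul_div_comm]
        congr 1 <;> ring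
    _ = _ := by
        rw [← this, Finset.mul_sum]
        exact Finset.sum_congr rfl fun j _ => by ring

end Pochhammer

section TruncatedSum

variable {L : Type*} [Field L]

/-- The truncated very-well-poised `₆φ₅` series in base `q⁴`. -/
noncomputable def truncatedSum (q a : L) (m : ℕ) : L :=
  ∑ k ∈ Finset.range (m + 1),
    qInt q (8 * (k : ℤ) + 1) *
      (qPoch q (q ^ 4) k ^ 2 * qPoch (a * q) (q ^ 4) k * qPoch (q / a) (q ^ 4) k) /
      (qPoch (q ^ 4) (q ^ 4) k ^ 2 * qPoch (a * q ^ 4) (q ^ 4) k *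
        qPoch (q ^ 4 / a) (q ^ 4) k) * q ^ (2 * k)

lemma truncatedSum_inv (q a : L) (m : ℕ) : truncatedSum q a⁻¹ m = truncatedSum q a m := by
  refine Finset.sum_congr rfl fun k _ => ?_
  rw [div_inv_eq_mul, div_inv_eq_mul, inv_mul_eq_div, inv_mul_eq_div, mul_comm q a,
    mul_comm (q ^ 4) a]
  congr 2 <;> ring

lemma qInt_natCast (q : L) (z : ℕ) : qInt q (z : ℤ) = (1 - q ^ z) / (1 - q) := by
  rw [qInt, zpow_natCast]

lemma qInt_eight (q : L) (k : ℕ) :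
    qInt q (8 * (k : ℤ) + 1) = (1 - q * (q ^ 4) ^ (2 * k)) / (1 - q) := by
  rw [show 8 * (k : ℤ) + 1 = ((8 * k + 1 : ℕ) : ℤ) by push_cast; ring, qInt_natCast,
    ← pow_mul, ← pow_succ']
  congr 4
  ring

lemma mul_truncatedSum {q : L} (hq : q ≠ 1) (a : L) (m : ℕ) :
    (1 - q) * truncatedSum q a m =
      ∑ k ∈ range (m + 1), (1 - q * (q ^ 4) ^ (2 * k)) *
        (qPoch q (q ^ 4) k ^ 2 * qPoch (a * q) (q ^ 4) k * qPoch (q / a) (q ^ 4) k) /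
        (qPoch (q ^ 4) (q ^ 4) k ^ 2 * qPoch (a * q ^ 4) (q ^ 4) k *
          qPoch (q ^ 4 / a) (q ^ 4) k) * (q ^ 2) ^ k := by
  rw [truncatedSum, Finset.mul_sum]
  refine Finset.sum_congr rfl fun k _ => ?_
  have : 1 - q ≠ 0 := sub_ne_zero.2 hq.symm
  rw [qInt_eight, pow_mul q 2 k]
  field_simp

lemma qPoch_self_ne_zero {q : L} (hq : ∀ i : ℕ, 0 < i → q ^ i ≠ 1) (c k : ℕ) (hc : 0 < c) :
    qPoch (q ^ c) (q ^ 4) k ≠ 0 :=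
  qPoch_ne_zero.2 fun i _ => by
    rw [← pow_mul, ← pow_add]
    exact hq _ (by omega)

/-- Watson's transformation of the truncated series, exhibiting the factor `[4m+1]`. -/
lemma truncatedSum_eq {q a : L} (hq0 : q ≠ 0) (hq : ∀ i : ℕ, 0 < i → q ^ i ≠ 1) (ha : a ≠ 0)
    (h2 : ∀ j, qPoch (q ^ 4 / a) (q ^ 4) j ≠ 0) (h3 : ∀ j, qPoch (a * q ^ 4) (q ^ 4) j ≠ 0)
    (m : ℕ) :
    truncatedSum q a m = (1 - q ^ (4 * m + 1)) / (1 - q) *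
      ((qPoch q (q ^ 4) m / qPoch (q ^ 4) (q ^ 4) m) ^ 2 * (q ^ m)⁻¹ *
        ∑ j ∈ range (m + 1), (1 - q ^ (4 * m + 1)) / (1 - q ^ (4 * j + 1)) *
          (qPoch ((q ^ 4) ^ m)⁻¹ (q ^ 4) j / qPoch (q ^ 4) (q ^ 4) j) *
          (qPoch (q * (q ^ 4) ^ (m + 1)) (q ^ 4) j * qPoch (q ^ 3) (q ^ 4) j * (q ^ 4) ^ j) /
          (qPoch (q ^ 4 / a) (q ^ 4) j * qPoch (a * q ^ 4) (q ^ 4) j)) := by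
  have hp : q ^ 4 ≠ 0 := pow_ne_zero _ hq0
  have h1 := fun j => qPoch_self_ne_zero hq 4 j (by norm_num)
  have hq1 : q ≠ 1 := by simpa using hq 1
  have hq1' : 1 - q ≠ 0 := sub_ne_zero.2 hq1.symm
  have e2 : q / a * q ^ 3 = q ^ 4 / a := by ring
  have e3 : a * q * q ^ 3 = a * q ^ 4 := by ring
  have key := wellPoised_sum_eq (p := q ^ 4) (b := a * q) (c := q / a) (e := q ^ 3) (A := q)
    (d := q) (g := q ^ 4) hp (by field_simp) h1 (by simpa only [e2]) (by simpa only [e3]) m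
  rw [e2, e3] at key
  apply mul_left_cancel₀ hq1'
  rw [mul_truncatedSum hq1]
  trans
  · refine Eq.trans (Finset.sum_congr rfl fun k _ => ?_) key
    rw [show q ^ 3 / q = q ^ 2 by field_simp]
    congr 1
    congr 1 <;> ring
  rw [Finset.mul_sum, Finset.mul_sum, Finset.mul_sum]
  refine Finset.sum_congr rfl fun j _ => ?_
  have hj : 1 - q * (q ^ 4) ^ j ≠ 0 := by
    rw [← pow_mul, ← pow_succ']
    exact sub_ne_zero.2 (hq _ (by omega)).symm
  have inner := wellPoised_inner_sum (p := q ^ 4) (A := q) (d := q) (g := q ^ 4) hp hq0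
    (by ring) h1 h1 j m
  rw [mul_comm, ← eq_div_iff hj] at inner
  rw [inner, pow_succ' q (4 * m), pow_succ' q (4 * j), pow_mul q 4 m, pow_mul q 4 j]
  have hs : (1 - q) * qPoch (q * q ^ 4) (q ^ 4) m = qPoch q (q ^ 4) m * (1 - q * (q ^ 4) ^ m) := by
    rw [← qPoch_succ', qPoch_succ]
  rw [mul_left_comm (1 - q) (qPoch _ _ (m + 1)), hs, qPoch_succ q]
  field_simp

lemma qPoch_mul_pow_ne_zero {q a : L} (hq0 : q ≠ 0) (hq : ∀ i : ℕ, 0 < i → q ^ i ≠ 1) {m : ℕ}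
    (ha : a * q ^ (4 * m + 1) = 1) (j : ℕ) : qPoch (a * q ^ 4) (q ^ 4) j ≠ 0 :=
  qPoch_ne_zero.2 fun i _ h => by
    have : q ^ (4 + 4 * i) = q ^ (4 * m + 1) := by
      rw [← mul_one (q ^ (4 * m + 1)), ← h, pow_add, pow_mul]
      linear_combination -(q ^ 4 * (q ^ 4) ^ i) * ha
    rcases lt_or_ge (4 + 4 * i) (4 * m + 1) with hlt | hge
    · apply hq (4 * m + 1 - (4 + 4 * i)) (by omega)
      apply mul_left_cancel₀ (pow_ne_zero (4 + 4 * i) hq0)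
      rw [← pow_add, mul_one, this]
      congr 1
      omega
    · apply hq (4 + 4 * i - (4 * m + 1)) (by omega)
      apply mul_left_cancel₀ (pow_ne_zero (4 * m + 1) hq0)
      rw [← pow_add, mul_one, ← this]
      congr 1
      omega

lemma pow_div_eq {q a : L} {m : ℕ} (ha : a * q ^ (4 * m + 1) = 1) :
    q ^ 4 / a = q * (q ^ 4) ^ (m + 1) := by
  have ha0 : a ≠ 0 := left_ne_zero_of_mul_eq_one ha
  rw [div_eq_iff ha0]
  linear_combination -q ^ 4 * ha

lemma qPoch_pow_div_ne_zero {q a : L} (hq : ∀ i : ℕ, 0 < i → q ^ i ≠ 1) {m : ℕ}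
    (ha : a * q ^ (4 * m + 1) = 1) (j : ℕ) : qPoch (q ^ 4 / a) (q ^ 4) j ≠ 0 := by
  rw [pow_div_eq ha, ← pow_mul, ← pow_succ']
  exact qPoch_self_ne_zero hq _ j (by omega)

/-- The terminating `₆φ₅` summation. -/
lemma truncatedSum_eq_of_mul_pow_eq_one {q a : L} (hq0 : q ≠ 0)
    (hq : ∀ i : ℕ, 0 < i → q ^ i ≠ 1) {m : ℕ} (ha : a * q ^ (4 * m + 1) = 1) :
    truncatedSum q a m = qPoch (q ^ 2) (q ^ 4) m / qPoch (q ^ 4) (q ^ 4) m *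
      ((1 - q ^ (4 * m + 1)) / (1 - q)) * (q ^ m)⁻¹ := by
  have hp : q ^ 4 ≠ 0 := pow_ne_zero _ hq0
  have ha0 : a ≠ 0 := left_ne_zero_of_mul_eq_one ha
  have h1 := fun j => qPoch_self_ne_zero hq 4 j (by norm_num)
  have hq1 : q ≠ 1 := by simpa using hq 1
  have hq1' : 1 - q ≠ 0 := sub_ne_zero.2 hq1.symm
  have e2 : q / a * (a * q ^ 3) = q ^ 4 := by field_simp
  have e3 : q * (a * q ^ 3) = a * q ^ 4 := by ring
  have h3 := qPoch_mul_pow_ne_zero hq0 hq ha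
  have eg := pow_div_eq ha
  have h4 := qPoch_pow_div_ne_zero hq ha
  have key := wellPoised_sum_eq (p := q ^ 4) (b := q) (c := q / a) (e := a * q ^ 3) (A := q)
    (d := a * q) (g := q ^ 4 / a) hp (by field_simp) h1 (by simpa only [e2])
    (by simpa only [e3]) m
  rw [e2, e3] at key
  have hdm : a * q * (q ^ 4) ^ m = 1 := by rw [← ha]; ring
  apply mul_left_cancel₀ hq1'
  rw [mul_truncatedSum hq1]
  trans
  · refine Eq.trans (Finset.sum_congr rfl fun k _ => ?_) key
    rw [show a * q ^ 3 / (a * q) = q ^ 2 by field_simp]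
    congr 1
    congr 1 <;> ring
  rw [Finset.sum_eq_single_of_mem m (by simp)]
  · rw [Finset.sum_eq_single_of_mem m (by simp)]
    · have hd : a * q = ((q ^ 4) ^ m)⁻¹ := eq_inv_of_mul_eq_one_left hdm
      have r1 := qPoch_reverse (x := a * q) (y := q ^ 4) (p := q ^ 4) (m := m)
        (by linear_combination q ^ 4 * hdm) hp
      have r2 := qPoch_reverse (x := a * q ^ 3) (y := q ^ 2) (p := q ^ 4) (m := m)
        (by linear_combination q ^ 4 * hdm) hp
      have r3 := qPoch_reverse (x := a * q ^ 4) (y := q) (p := q ^ 4) (m := m)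
        (by linear_combination q ^ 4 * hdm) hp
      have hw : (∏ i ∈ range m, (q ^ 4) ^ i) ^ 2 * (q ^ 4) ^ m = (q ^ 4) ^ (m * m) := by
        rw [Finset.prod_pow_eq_pow_sum, ← pow_mul, Finset.sum_range_id_mul_two, ← pow_add]
        congr 1
        cases m with
        | zero => rfl
        | succ m => rw [Nat.add_sub_cancel]; ring
      have hs : (1 - q * (q ^ 4) ^ (2 * m)) * (qPoch q (q ^ 4) m *
          qPoch (q * (q ^ 4) ^ m) (q ^ 4) m) = qPoch q (q ^ 4) m *
          ((1 - q * (q ^ 4) ^ m) * qPoch (q ^ 4 / a) (q ^ 4) m) := by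
        rw [eg, ← qPoch_add, ← two_mul, mul_comm, ← qPoch_succ, ← mul_assoc, ← qPoch_succ,
          ← qPoch_add]
        congr 1
        ring
      have hdpow : (a * q) ^ m * (q ^ 4) ^ (m * m) = 1 := by
        rw [pow_mul, ← mul_pow, hdm, one_pow]
      have hsgn : ((-1 : L) ^ m) ^ 2 = 1 := by rw [← pow_mul, mul_comm, pow_mul]; simp
      have b1 := h1 m
      have b3 := h3 m
      have b4 := h4 m
      rw [← hd, pow_succ' q (4 * m), pow_mul q 4 m]
      have hQ : qPoch (a * q ^ 3) (q ^ 4) m * q ^ m * qPoch q (q ^ 4) m =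
          qPoch (q ^ 2) (q ^ 4) m * qPoch (a * q ^ 4) (q ^ 4) m := by
        rw [← r2, ← r3]
        ring
      have hP : qPoch (a * q) (q ^ 4) m ^ 2 * (q ^ 4) ^ m =
          qPoch (q ^ 4) (q ^ 4) m ^ 2 * (a * q) ^ m := by
        rw [← r1]
        linear_combination -(qPoch (a * q) (q ^ 4) m ^ 2 * (q ^ 4) ^ m) *
          (hdpow + (a * q) ^ m * hw + (a * q) ^ m * (q ^ 4) ^ m *
            (∏ i ∈ range m, (q ^ 4) ^ i) ^ 2 * hsgn)
      have haq : a * q ≠ 0 := mul_ne_zero ha0 hq0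
      calc _ = qPoch (a * q ^ 3) (q ^ 4) m * (qPoch (a * q) (q ^ 4) m ^ 2 * (q ^ 4) ^ m) *
            ((1 - q * (q ^ 4) ^ (2 * m)) * (qPoch q (q ^ 4) m *
              qPoch (q * (q ^ 4) ^ m) (q ^ 4) m)) /
            (qPoch (q ^ 4) (q ^ 4) m ^ 3 * qPoch (a * q ^ 4) (q ^ 4) m *
              qPoch (q ^ 4 / a) (q ^ 4) m * (a * q) ^ m) := by
            rw [div_mul_eq_mul_div, div_mul_eq_mul_div, mul_div_assoc', div_div]
            congr 1 <;> ring
        _ = qPoch (a * q ^ 3) (q ^ 4) m * q ^ m * qPoch q (q ^ 4) m * (1 - q * (q ^ 4) ^ m) /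
            (qPoch (q ^ 4) (q ^ 4) m * qPoch (a * q ^ 4) (q ^ 4) m * q ^ m) := by
            rw [hP, hs]
            have b5 := pow_ne_zero m haq
            clear * - b1 b3 b4 b5 hq0
            generalize qPoch (q ^ 4 / a) (q ^ 4) m = G at b4 ⊢
            generalize qPoch (a * q ^ 4) (q ^ 4) m = Y at b3 ⊢
            generalize qPoch (q ^ 4) (q ^ 4) m = P at b1 ⊢
            generalize (a * q) ^ m = Z at b5 ⊢
            field_simp
        _ = _ := by
            rw [hQ]
            clear * - b1 b3 hq0 hq1'
            generalize qPoch (a * q ^ 4) (q ^ 4) m = Y at b3 ⊢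
            generalize qPoch (q ^ 4) (q ^ 4) m = P at b1 ⊢
            field_simp
    · intro k hk hkm
      rw [qPoch_inv_pow_eq_zero hp (by simp at hk; omega)]
      ring
  · intro j hj hjm
    have hjm : j < m := by simp at hj; omega
    have inner := wellPoised_inner_sum (p := q ^ 4) (A := q) (d := a * q) (g := q ^ 4 / a) hp
      (mul_ne_zero ha0 hq0) (by field_simp) h1 h4 j m
    have hz : qPoch (a * q * q ^ 4) (q ^ 4) m = 0 := by
      obtain ⟨l, rfl⟩ : ∃ l, m = l + 1 := ⟨m - 1, by omega⟩
      rw [qPoch_succ, mul_assoc (a * q), ← pow_succ', hdm]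
      simp
    rw [hz] at inner
    have hj : 1 - a * q * (q ^ 4) ^ j ≠ 0 := by
      intro h
      apply hq (4 * (m - j)) (by omega)
      have hm : (q ^ 4) ^ m = (q ^ 4) ^ j * q ^ (4 * (m - j)) := by
        rw [← pow_mul, ← pow_mul, ← pow_add]
        congr 1
        omega
      rw [hm] at hdm
      linear_combination hdm + q ^ (4 * (m - j)) * h
    simp only [mul_zero, zero_mul, zero_div, mul_eq_zero, hj, false_or] at inner
    rw [inner, mul_zero]

end TruncatedSum

section Residue

variable {K S : Type*} [Field K]

/-- The graph of the residue map induced by `φ : K[X] → S` on the rational functions whose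
denominator is sent to a unit. -/
def residueGraph [CommRing S] (φ : K[X] →+* S) : Subring (RatFunc K × S) where
  carrier := {z | ∃ f g : K[X], IsUnit (φ g) ∧
    z.1 * algebraMap K[X] (RatFunc K) g = algebraMap K[X] (RatFunc K) f ∧ φ f = z.2 * φ g}
  mul_mem' := by
    rintro ⟨x, s⟩ ⟨y, t⟩ ⟨f, g, hg, h1, h2⟩ ⟨f', g', hg', h1', h2'⟩
    refine ⟨f * f', g * g', by simpa using hg.mul hg', ?_, ?_⟩
    · simp only [Prod.mk_mul_mk, map_mul, ← h1, ← h1']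
      ring
    · simp only [Prod.mk_mul_mk, map_mul, h2, h2']
      ring
  one_mem' := ⟨1, 1, by simp, by simp, by simp⟩
  add_mem' := by
    rintro ⟨x, s⟩ ⟨y, t⟩ ⟨f, g, hg, h1, h2⟩ ⟨f', g', hg', h1', h2'⟩
    refine ⟨f * g' + f' * g, g * g', by simpa using hg.mul hg', ?_, ?_⟩
    · simp only [Prod.mk_add_mk, map_mul, map_add, ← h1, ← h1']
      ring
    · simp only [Prod.mk_add_mk, map_mul, map_add, h2, h2']
      ring
  zero_mem' := ⟨0, 1, by simp, by simp, by simp⟩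
  neg_mem' := by
    rintro ⟨x, s⟩ ⟨f, g, hg, h1, h2⟩
    refine ⟨-f, g, hg, ?_, ?_⟩
    · simpa using h1
    · simpa using h2

/-- The rational function `x` has residue `s` under `φ : K[X] → S`. -/
def HasResidue [CommRing S] (φ : K[X] →+* S) (x : RatFunc K) (s : S) : Prop :=
  (x, s) ∈ residueGraph φ

namespace HasResidue

section CommRing

variable [CommRing S] {φ : K[X] →+* S} {x y : RatFunc K} {s t : S}

lemma algebraMap (φ : K[X] →+* S) (f : K[X]) :
    HasResidue φ (algebraMap K[X] (RatFunc K) f) (φ f) :=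
  ⟨f, 1, by simp, by simp, by simp⟩

lemma one : HasResidue φ 1 1 := one_mem (residueGraph φ)

lemma mul (hx : HasResidue φ x s) (hy : HasResidue φ y t) : HasResidue φ (x * y) (s * t) :=
  mul_mem (S := Subring (RatFunc K × S)) hx hy

lemma sub (hx : HasResidue φ x s) (hy : HasResidue φ y t) : HasResidue φ (x - y) (s - t) :=
  sub_mem (S := Subring (RatFunc K × S)) hx hy

lemma pow (hx : HasResidue φ x s) (k : ℕ) : HasResidue φ (x ^ k) (s ^ k) :=
  pow_mem (A := Subring (RatFunc K × S)) hx k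

lemma sum {ι : Type*} {f : ι → RatFunc K} {g : ι → S} {T : Finset ι}
    (h : ∀ i ∈ T, HasResidue φ (f i) (g i)) : HasResidue φ (∑ i ∈ T, f i) (∑ i ∈ T, g i) := by
  have : ∑ i ∈ T, (f i, g i) ∈ residueGraph φ := sum_mem h
  rwa [show ∑ i ∈ T, (f i, g i) = (∑ i ∈ T, f i, ∑ i ∈ T, g i) from
    Prod.ext Prod.fst_sum Prod.snd_sum] at this

lemma prod {ι : Type*} {f : ι → RatFunc K} {g : ι → S} {T : Finset ι}
    (h : ∀ i ∈ T, HasResidue φ (f i) (g i)) : HasResidue φ (∏ i ∈ T, f i) (∏ i ∈ T, g i) := by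
  have : ∏ i ∈ T, (f i, g i) ∈ residueGraph φ := prod_mem h
  rwa [show ∏ i ∈ T, (f i, g i) = (∏ i ∈ T, f i, ∏ i ∈ T, g i) from
    Prod.ext Prod.fst_prod Prod.snd_prod] at this

lemma inv [Nontrivial S] (h : HasResidue φ x s) (hst : s * t = 1) : HasResidue φ x⁻¹ t := by
  obtain ⟨f, g, hg, h1, h2⟩ := h
  simp only at h1 h2
  have hf : IsUnit (φ f) := h2 ▸ (IsUnit.of_mul_eq_one t hst).mul hg
  have hf0 : f ≠ 0 := by
    rintro rfl
    simp at hf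
  have hx : x ≠ 0 := by
    rintro rfl
    rw [zero_mul] at h1
    exact hf0 ((map_eq_zero_iff _ (RatFunc.algebraMap_injective K)).1 h1.symm)
  refine ⟨g, f, hf, ?_, ?_⟩
  · simp only [← h1, inv_mul_cancel_left₀ hx]
  · simp only [h2]
    linear_combination -(φ g) * hst

end CommRing

variable [Field S] {φ : K[X] →+* S}

lemma div {x y : RatFunc K} {s t : S} (hx : HasResidue φ x s) (hy : HasResidue φ y t)
    (ht : t ≠ 0) : HasResidue φ (x / y) (s / t) := by
  rw [div_eq_mul_inv, div_eq_mul_inv]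
  exact hx.mul (hy.inv (mul_inv_cancel₀ ht))

lemma qPoch {x r : RatFunc K} {s ρ : S} (hx : HasResidue φ x s) (hr : HasResidue φ r ρ) (k : ℕ) :
    HasResidue φ (qPoch x r k) (qPoch s ρ k) :=
  prod fun i _ => one.sub (hx.mul (hr.pow i))

lemma truncatedSum {q a : RatFunc K} {ζ c : S} (hq : HasResidue φ q ζ) (ha : HasResidue φ a c)
    (hζ : ∀ i : ℕ, 0 < i → ζ ^ i ≠ 1) (hc : c ≠ 0)
    (h1 : ∀ j, _root_.qPoch (ζ ^ 4 / c) (ζ ^ 4) j ≠ 0)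
    (h2 : ∀ j, _root_.qPoch (c * ζ ^ 4) (ζ ^ 4) j ≠ 0) (m : ℕ) :
    HasResidue φ (truncatedSum q a m) (truncatedSum ζ c m) := by
  have hζ1 : 1 - ζ ≠ 0 := sub_ne_zero.2 fun h => hζ 1 one_pos (by rw [pow_one, h])
  have hp := hq.pow 4
  refine sum fun k _ => (((?_ : HasResidue φ _ _).mul
    ((((hq.qPoch hp k).pow 2).mul ((ha.mul hq).qPoch hp k)).mul ((hq.div ha hc).qPoch hp k))).div
    ((((hp.qPoch hp k).pow 2).mul ((ha.mul hp).qPoch hp k)).mul ((hp.div ha hc).qPoch hp k))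
    ?_).mul (hq.pow _)
  · rw [show 8 * (k : ℤ) + 1 = ((8 * k + 1 : ℕ) : ℤ) by push_cast; ring, qInt_natCast,
      qInt_natCast]
    exact (one.sub (hq.pow _)).div (one.sub hq) hζ1
  · exact mul_ne_zero (mul_ne_zero (pow_ne_zero 2 (qPoch_self_ne_zero hζ 4 k (by norm_num)))
      (h2 k)) (h1 k)

end HasResidue

end Residue

section Congruence

variable {K : Type*} [Field K]

lemma isUnit_mk_iff {M g : K[X]} : IsUnit (AdjoinRoot.mk M g) ↔ IsCoprime M g := by
  constructor
  · intro h
    obtain ⟨u, hu⟩ := h.exists_right_inv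
    obtain ⟨u, rfl⟩ := AdjoinRoot.mk_surjective u
    rw [← map_mul, ← map_one (AdjoinRoot.mk M), AdjoinRoot.mk_eq_mk] at hu
    obtain ⟨v, hv⟩ := hu
    exact ⟨-v, u, by linear_combination hv⟩
  · rintro ⟨u, v, h⟩
    refine IsUnit.of_mul_eq_one (AdjoinRoot.mk M v) ?_
    rw [← map_mul, ← map_one (AdjoinRoot.mk M), AdjoinRoot.mk_eq_mk]
    exact ⟨-u, by linear_combination h⟩

/-- `M` divides the numerator of `x` in lowest terms. -/
def DvdNum (M : K[X]) (x : RatFunc K) : Prop :=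
  ∃ f g : K[X], IsCoprime M g ∧
    x * algebraMap K[X] (RatFunc K) g =
      algebraMap K[X] (RatFunc K) M * algebraMap K[X] (RatFunc K) f

lemma DvdNum.mul {M N : K[X]} {x : RatFunc K} (h : IsCoprime M N) (hM : DvdNum M x)
    (hN : DvdNum N x) : DvdNum (M * N) x := by
  obtain ⟨f, g, hg, e⟩ := hM
  obtain ⟨f', g', hg', e'⟩ := hN
  obtain ⟨u, v, huv⟩ := h
  have c1 : IsCoprime M (v * N) := ⟨u, 1, by linear_combination huv⟩
  have c2 : IsCoprime N (u * M) := ⟨v, 1, by linear_combination huv⟩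
  refine ⟨v * f + u * f', v * N * g + u * M * g', IsCoprime.mul_left ?_ ?_, ?_⟩
  · rw [mul_comm u, mul_assoc M]
    exact (c1.mul_right hg).add_mul_left_right _
  · rw [add_comm, mul_comm v, mul_assoc N]
    exact (c2.mul_right hg').add_mul_left_right _
  · simp only [map_add, map_mul]
    linear_combination algebraMap K[X] (RatFunc K) v * algebraMap K[X] (RatFunc K) N * e +
      algebraMap K[X] (RatFunc K) u * algebraMap K[X] (RatFunc K) M * e'

lemma DvdNum.isUnit_mul {M U : K[X]} {x : RatFunc K} (hU : IsUnit U) (hM : DvdNum M x) :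
    DvdNum (U * M) x := by
  obtain ⟨f, g, hg, e⟩ := hM
  obtain ⟨V, hV⟩ := hU.exists_right_inv
  refine ⟨V * f, g, (isCoprime_mul_unit_left_left hU _ _).2 hg, ?_⟩
  rw [e, ← map_mul, ← map_mul]
  congr 1
  linear_combination -M * f * hV

lemma HasResidue.dvdNum {M : K[X]} {x : RatFunc K} (h : HasResidue (AdjoinRoot.mk M) x 0) :
    DvdNum M x := by
  obtain ⟨f, g, hg, e, hf⟩ := h
  rw [zero_mul, AdjoinRoot.mk_eq_zero] at hf
  obtain ⟨f, rfl⟩ := hf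
  exact ⟨f, g, isUnit_mk_iff.1 hg, by rw [← map_mul, ← e]⟩

/-- The congruence holds modulo `qⁿ - b`. -/
lemma dvdNum_X_pow_sub_C {m : ℕ} {b : K} (hb : ∀ k : ℕ, 0 < k → b ^ k ≠ 1)
    (hirr : Irreducible (X ^ (4 * m + 1) - C b : K[X])) (hb0 : b ≠ 0) :
    DvdNum (X ^ (4 * m + 1) - C b) (truncatedSum RatFunc.X (RatFunc.C b⁻¹) m -
      qPoch (RatFunc.X ^ 2) (RatFunc.X ^ 4) m / qPoch (RatFunc.X ^ 4) (RatFunc.X ^ 4) m *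
        ((1 - RatFunc.X ^ (4 * m + 1)) / (1 - RatFunc.X)) * (RatFunc.X ^ m)⁻¹) := by
  apply HasResidue.dvdNum
  have : Fact (Irreducible (X ^ (4 * m + 1) - C b : K[X])) := ⟨hirr⟩
  have hq := HasResidue.algebraMap (AdjoinRoot.mk (X ^ (4 * m + 1) - C b : K[X])) X
  have ha := HasResidue.algebraMap (AdjoinRoot.mk (X ^ (4 * m + 1) - C b : K[X])) (C b⁻¹)
  have hζb : AdjoinRoot.mk (X ^ (4 * m + 1) - C b : K[X]) X ^ (4 * m + 1) =
      AdjoinRoot.mk (X ^ (4 * m + 1) - C b : K[X]) (C b) := by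
    rw [← map_pow, AdjoinRoot.mk_eq_mk]
  generalize AdjoinRoot.mk (X ^ (4 * m + 1) - C b : K[X]) = φ at *
  rw [RatFunc.algebraMap_X] at hq
  rw [RatFunc.algebraMap_C] at ha
  have hc : φ (C b⁻¹) * φ X ^ (4 * m + 1) = 1 := by
    rw [hζb, ← map_mul, ← map_mul, inv_mul_cancel₀ hb0, map_one, map_one]
  have hζ : ∀ i : ℕ, 0 < i → φ X ^ i ≠ 1 := fun i hi h => by
    apply hb i hi
    apply (φ.comp C).injective
    rw [map_pow, map_one, RingHom.comp_apply, ← hζb, pow_right_comm, h, one_pow]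
  have hζ0 : φ X ≠ 0 := fun h => by simp [h] at hc
  have hp := hq.pow 4
  have hζ1 : 1 - φ X ≠ 0 := sub_ne_zero.2 fun h => hζ 1 one_pos (by rw [pow_one, h])
  have h := (hq.truncatedSum ha hζ (left_ne_zero_of_mul_eq_one hc) (qPoch_pow_div_ne_zero hζ hc)
    (qPoch_mul_pow_ne_zero hζ0 hζ hc) m).sub (((((hq.pow 2).qPoch hp m).div (hp.qPoch hp m)
      (qPoch_self_ne_zero hζ 4 m (by norm_num))).mul
    ((HasResidue.one.sub (hq.pow (4 * m + 1))).div (HasResidue.one.sub hq) hζ1)).mul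
    ((hq.pow m).inv (mul_inv_cancel₀ (pow_ne_zero m hζ0))))
  rwa [truncatedSum_eq_of_mul_pow_eq_one hζ0 hζ hc, sub_self] at h

end Congruence

section Integrality

variable {K : Type*} [Field K]

/-- The rational functions whose denominator in lowest terms is coprime to `M`. -/
noncomputable def integralRing (M : K[X]) : Subring (RatFunc K) :=
  (residueGraph (AdjoinRoot.mk M)).map (RingHom.fst _ _)

lemma mem_integralRing {M : K[X]} {x : RatFunc K} : x ∈ integralRing M ↔ ∃ f g : K[X],
    IsCoprime M g ∧ x * algebraMap K[X] (RatFunc K) g = algebraMap K[X] (RatFunc K) f := by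
  constructor
  · rintro ⟨⟨x, s⟩, ⟨f, g, hg, h1, -⟩, rfl⟩
    exact ⟨f, g, isUnit_mk_iff.1 hg, h1⟩
  · rintro ⟨f, g, hg, h⟩
    have hu := isUnit_mk_iff.2 hg
    obtain ⟨u, hu'⟩ := hu.exists_left_inv
    exact ⟨(x, AdjoinRoot.mk M f * u), ⟨f, g, hu, h, by rw [mul_assoc, hu', mul_one]⟩, rfl⟩

lemma algebraMap_mem_integralRing (M f : K[X]) :
    algebraMap K[X] (RatFunc K) f ∈ integralRing M :=
  mem_integralRing.2 ⟨f, 1, isCoprime_one_right, by simp⟩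

lemma inv_algebraMap_mem_integralRing {M g : K[X]} (h : IsCoprime M g) :
    (algebraMap K[X] (RatFunc K) g)⁻¹ ∈ integralRing M := by
  rcases eq_or_ne g 0 with rfl | hg
  · simp
  · refine mem_integralRing.2 ⟨1, g, h, ?_⟩
    rw [map_one, inv_mul_cancel₀]
    exact (map_ne_zero_iff _ (RatFunc.algebraMap_injective K)).2 hg

lemma X_mem_integralRing (M : K[X]) : (RatFunc.X : RatFunc K) ∈ integralRing M := by
  simpa using algebraMap_mem_integralRing M X

lemma ratFunc_X_pow_ne_one {i : ℕ} (hi : 0 < i) : (RatFunc.X : RatFunc K) ^ i ≠ 1 := by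
  rw [← RatFunc.algebraMap_X, ← map_pow, ← map_one (algebraMap K[X] (RatFunc K))]
  intro h
  have := congrArg natDegree (RatFunc.algebraMap_injective K h)
  rw [natDegree_X_pow, natDegree_one] at this
  omega

lemma inv_X_pow_mem_integralRing {n : ℕ} (hn : 0 < n) (k : ℕ) :
    ((RatFunc.X : RatFunc K) ^ k)⁻¹ ∈ integralRing (1 - X ^ n : K[X]) := by
  rw [← RatFunc.algebraMap_X, ← map_pow]
  refine inv_algebraMap_mem_integralRing (IsCoprime.pow_right ⟨1, X ^ (n - 1), ?_⟩)
  rw [← pow_succ, Nat.sub_add_cancel hn]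
  ring

lemma dvdNum_mul {M N : K[X]} (h : M ∣ N) {x : RatFunc K} (hx : x ∈ integralRing N) :
    DvdNum M (algebraMap K[X] (RatFunc K) M * x) := by
  obtain ⟨f, g, hg, e⟩ := mem_integralRing.1 hx
  exact ⟨f, g, hg.of_isCoprime_of_dvd_left h, by rw [mul_assoc, e]⟩

lemma isCoprime_geom_sum {R : Type*} [CommRing R] (y : R) {s t : ℕ} (h : Nat.Coprime s t) :
    IsCoprime (∑ i ∈ range s, y ^ i) (∑ i ∈ range t, y ^ i) := by
  rcases lt_or_ge 1 t with ht | ht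
  · obtain ⟨u, -, hu⟩ := Nat.exists_mul_mod_eq_one_of_coprime h ht
    have key : ∀ l w, ∑ i ∈ range (l * w), y ^ i =
        (∑ i ∈ range l, y ^ i) * ∑ i ∈ range w, (y ^ l) ^ i := fun l w => by
      induction w with
      | zero => simp
      | succ w ih =>
        rw [Nat.mul_succ, Finset.sum_range_add, ih, Finset.sum_range_succ, mul_add, Finset.mul_sum,
          ← pow_mul, add_right_inj, Finset.sum_mul]
        exact Finset.sum_congr rfl fun i _ => by rw [pow_add, mul_comm]
    have e := key s u
    rw [← Nat.div_add_mod (s * u) t, hu, Finset.sum_range_succ'] at e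
    simp only [pow_succ, ← Finset.sum_mul] at e
    rw [key, pow_zero] at e
    exact ⟨∑ i ∈ range u, (y ^ s) ^ i, -(∑ i ∈ range (s * u / t), (y ^ t) ^ i) * y, by
      linear_combination -e⟩
  · interval_cases t
    · rw [Nat.coprime_zero_right] at h
      subst h
      simpa using isCoprime_one_left
    · simpa using isCoprime_one_right

/-- The quotient `(1-y^t)/(1-y)` is coprime to `1-y^n` if `t` and `n` are coprime. -/
lemma isCoprime_one_sub_pow_geom_sum [CharZero K] (y : K[X]) {t n : ℕ} (ht : 0 < t)
    (h : Nat.Coprime n t) : IsCoprime (1 - y ^ n) (∑ i ∈ range t, y ^ i) := by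
  rw [← mul_neg_geom_sum]
  refine IsCoprime.mul_left ?_ (isCoprime_geom_sum y h)
  have hd : 1 - y ∣ ∑ i ∈ range t, (1 - y ^ i) :=
    Finset.dvd_sum fun i _ => Dvd.intro _ (mul_neg_geom_sum y i)
  obtain ⟨w, hw⟩ := hd
  rw [Finset.sum_sub_distrib, Finset.sum_const, Finset.card_range, nsmul_one] at hw
  have ht' : C ((t : K)⁻¹) * (t : K[X]) = 1 := by
    rw [← C_eq_natCast, ← map_mul, inv_mul_cancel₀ (by exact_mod_cast ht.ne'), map_one]
  exact ⟨C (t : K)⁻¹ * w, C (t : K)⁻¹, by linear_combination ht' - C (t : K)⁻¹ * hw⟩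

/-- Integrality of `(1-q^s)/(1-q^t)` modulo `1-q^n`. -/
lemma one_sub_pow_div_mem [CharZero K] {n s t : ℕ} (ht : 0 < t) (h : Nat.gcd t n ∣ s) :
    (1 - RatFunc.X ^ s) / (1 - RatFunc.X ^ t) ∈ integralRing (1 - X ^ n : K[X]) := by
  obtain ⟨w, rfl⟩ := h
  have hd : 0 < Nat.gcd t n := Nat.gcd_pos_of_pos_left _ ht
  obtain ⟨t', ht'⟩ := Nat.gcd_dvd_left t n
  obtain ⟨n', hn'⟩ := Nat.gcd_dvd_right t n
  have hcop : Nat.Coprime n' t' := by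
    have := Nat.coprime_div_gcd_div_gcd hd
    rw [Nat.div_eq_of_eq_mul_right hd ht', Nat.div_eq_of_eq_mul_right hd hn'] at this
    exact this.symm
  generalize Nat.gcd t n = d at *
  subst ht' hn'
  have key := isCoprime_one_sub_pow_geom_sum (X ^ d : K[X]) (Nat.pos_of_mul_pos_left ht) hcop
  rw [← pow_mul] at key
  have hX : (1 : RatFunc K) - RatFunc.X ^ d ≠ 0 :=
    sub_ne_zero.2 (ratFunc_X_pow_ne_one hd).symm
  have e : (1 - RatFunc.X ^ (d * w)) / (1 - RatFunc.X ^ (d * t')) =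
      algebraMap K[X] (RatFunc K) (∑ i ∈ range w, (X ^ d) ^ i) *
        (algebraMap K[X] (RatFunc K) (∑ i ∈ range t', (X ^ d) ^ i))⁻¹ := by
    rw [pow_mul, pow_mul, ← mul_neg_geom_sum (RatFunc.X ^ d), ← mul_neg_geom_sum (RatFunc.X ^ d),
      mul_div_mul_left _ _ hX, div_eq_mul_inv]
    simp
  rw [e]
  exact mul_mem (algebraMap_mem_integralRing _ _) (inv_algebraMap_mem_integralRing key)

/-- Integrality of the Gaussian binomial coefficients. -/
lemma qPoch_pow_div_mem {L : Type*} [Field L] (A : Subring L) {p : L} (hp : p ∈ A)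
    (h1 : ∀ j, qPoch p p j ≠ 0) (r k : ℕ) : qPoch (p ^ r) p k / qPoch p p k ∈ A := by
  induction k generalizing r with
  | zero => simp [qPoch_zero, one_mem]
  | succ k ihk =>
    induction r with
    | zero => simp [qPoch_succ', zero_mem]
    | succ r ihr =>
      have e : qPoch (p ^ (r + 1)) p (k + 1) / qPoch p p (k + 1) =
          qPoch (p ^ r) p (k + 1) / qPoch p p (k + 1) +
            p ^ r * (qPoch (p ^ (r + 1)) p k / qPoch p p k) := by
        have a1 := h1 (k + 1)
        rw [qPoch_succ] at a1
        have a2 := left_ne_zero_of_mul a1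
        have a3 := right_ne_zero_of_mul a1
        rw [qPoch_succ (p ^ (r + 1)) p, qPoch_succ' (p ^ r), qPoch_succ p p, ← pow_succ,
          div_add' _ _ _ a1, div_left_inj' a1]
        field_simp
        ring
      rw [e]
      exact add_mem ihr (mul_mem (pow_mem hp r) (ihk _))

lemma prod_div_qPoch_mem [CharZero K] {n r k : ℕ} {s : ℕ → ℕ} (hr : 0 < r)
    (h : ∀ i < k, Nat.gcd (4 * (i + r)) n ∣ s i) :
    (∏ i ∈ range k, (1 - RatFunc.X ^ s i)) / qPoch (RatFunc.X ^ 4) (RatFunc.X ^ 4) k ∈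
      integralRing (1 - X ^ n : K[X]) := by
  have e : (∏ i ∈ range k, (1 - RatFunc.X ^ s i)) / qPoch (RatFunc.X ^ 4) (RatFunc.X ^ 4) k =
      (∏ i ∈ range k, (1 - (RatFunc.X : RatFunc K) ^ s i) / (1 - RatFunc.X ^ (4 * (i + r)))) *
        (qPoch ((RatFunc.X ^ 4) ^ r) (RatFunc.X ^ 4) k /
          qPoch (RatFunc.X ^ 4) (RatFunc.X ^ 4) k) := by
    have h0 : ∏ i ∈ range k, (1 - (RatFunc.X : RatFunc K) ^ (4 * (i + r))) ≠ 0 :=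
      Finset.prod_ne_zero_iff.2 fun i _ =>
        sub_ne_zero.2 (ratFunc_X_pow_ne_one (by omega)).symm
    have h2 : qPoch ((RatFunc.X ^ 4) ^ r) (RatFunc.X ^ 4) k =
        ∏ i ∈ range k, (1 - (RatFunc.X : RatFunc K) ^ (4 * (i + r))) :=
      Finset.prod_congr rfl fun i _ => by rw [← pow_add, ← pow_mul, add_comm]
    rw [h2, Finset.prod_div_distrib, div_mul_div_cancel₀ h0]
  rw [e]
  exact mul_mem (prod_mem fun i hi => one_sub_pow_div_mem (by omega) (h i (by simpa using hi)))
    (qPoch_pow_div_mem _ (pow_mem (X_mem_integralRing _) 4)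
      (fun j => qPoch_self_ne_zero (fun i hi => ratFunc_X_pow_ne_one hi) 4 j (by norm_num)) r k)

lemma qPoch_mem {L : Type*} [Field L] (A : Subring L) {x r : L} (hx : x ∈ A) (hr : r ∈ A) (k : ℕ) :
    qPoch x r k ∈ A :=
  prod_mem fun i _ => sub_mem (one_mem _) (mul_mem hx (pow_mem hr i))

lemma isCoprime_one_sub_C_mul_X_pow {n : ℕ} {c : K} (hc : c ^ n ≠ 1) (t : ℕ) :
    IsCoprime (1 - X ^ n : K[X]) (1 - C c * X ^ t) := by
  have h1 := mul_neg_geom_sum (C c * X ^ t : K[X]) n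
  have h2 := mul_neg_geom_sum (X ^ n : K[X]) t
  rw [mul_pow, ← C_pow, pow_right_comm] at h1
  have h3 : C ((1 - c ^ n)⁻¹) * (1 - C (c ^ n) : K[X]) = 1 := by
    rw [← C_1, ← C_sub, ← C_mul, inv_mul_cancel₀ (sub_ne_zero.2 hc.symm)]
  exact ⟨-C ((1 - c ^ n)⁻¹) * C (c ^ n) * ∑ i ∈ range t, (X ^ n) ^ i,
    C ((1 - c ^ n)⁻¹) * ∑ i ∈ range n, (C c * X ^ t) ^ i, by
      linear_combination h3 + C ((1 - c ^ n)⁻¹) * h1 - C ((1 - c ^ n)⁻¹) * C (c ^ n) * h2⟩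

lemma qPoch_C_mul_eq (c : K) (j : ℕ) : qPoch (RatFunc.C c * RatFunc.X ^ 4) (RatFunc.X ^ 4) j =
    ∏ i ∈ range j, algebraMap K[X] (RatFunc K) (1 - C c * X ^ (4 * (i + 1))) := by
  refine Finset.prod_congr rfl fun i _ => ?_
  simp only [map_sub, map_one, map_mul, map_pow, RatFunc.algebraMap_C, RatFunc.algebraMap_X]
  ring

lemma inv_qPoch_C_mul_mem {n : ℕ} {c : K} (hc : c ^ n ≠ 1) (j : ℕ) :
    (qPoch (RatFunc.C c * RatFunc.X ^ 4) (RatFunc.X ^ 4) j)⁻¹ ∈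
      integralRing (1 - X ^ n : K[X]) := by
  rw [qPoch_C_mul_eq, ← Finset.prod_inv_distrib]
  exact prod_mem fun i _ => inv_algebraMap_mem_integralRing (isCoprime_one_sub_C_mul_X_pow hc _)

lemma qPoch_C_mul_ne_zero (c : K) (j : ℕ) :
    qPoch (RatFunc.C c * RatFunc.X ^ 4) (RatFunc.X ^ 4) j ≠ 0 := by
  rw [qPoch_C_mul_eq, Finset.prod_ne_zero_iff]
  intro i _
  rw [map_ne_zero_iff _ (RatFunc.algebraMap_injective K)]
  intro h
  simpa using congrArg (eval 0) h

lemma qPoch_X_div_mem [CharZero K] (m : ℕ) :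
    qPoch RatFunc.X (RatFunc.X ^ 4) m / qPoch (RatFunc.X ^ 4) (RatFunc.X ^ 4) m ∈
      integralRing (1 - X ^ (4 * m + 1) : K[X]) := by
  have := prod_div_qPoch_mem (K := K) (n := 4 * m + 1) (r := 3 * m + 1) (k := m)
    (s := fun i => 4 * i + 1) (by omega) fun i _ => by
      refine (Nat.dvd_add_left (Dvd.dvd.mul_left (Nat.gcd_dvd_right _ _) 3)).1 ?_
      convert Nat.gcd_dvd_left _ _ using 1
      ring
  convert this using 2
  exact Finset.prod_congr rfl fun i _ => by ring

lemma qPoch_X_sq_div_mem [CharZero K] (m : ℕ) :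
    qPoch (RatFunc.X ^ 2) (RatFunc.X ^ 4) m / qPoch (RatFunc.X ^ 4) (RatFunc.X ^ 4) m ∈
      integralRing (1 - X ^ (4 * m + 1) : K[X]) := by
  have := prod_div_qPoch_mem (K := K) (n := 4 * m + 1) (r := 6 * m + 2) (k := m)
    (s := fun i => 4 * i + 2) (by omega) fun i _ => by
      refine (Nat.dvd_add_left (Dvd.dvd.mul_left (Nat.gcd_dvd_right _ _) 6)).1 ?_
      convert Nat.gcd_dvd_left _ _ using 1
      ring
  convert this using 2
  exact Finset.prod_congr rfl fun i _ => by ring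

lemma qPoch_inv_X_pow_div_mem [CharZero K] {m j : ℕ} (hj : j ≤ m) :
    qPoch ((RatFunc.X ^ 4) ^ m)⁻¹ (RatFunc.X ^ 4) j / qPoch (RatFunc.X ^ 4) (RatFunc.X ^ 4) j ∈
      integralRing (1 - X ^ (4 * m + 1) : K[X]) := by
  have := prod_div_qPoch_mem (K := K) (n := 4 * m + 1) (r := 3 * m + 1) (k := j)
    (s := fun i => 4 * (m - i)) (by omega) fun i hi => by
      refine (Nat.dvd_add_right (Nat.gcd_dvd_left (4 * (i + (3 * m + 1))) (4 * m + 1))).1 ?_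
      rw [← mul_add, show i + (3 * m + 1) + (m - i) = 4 * m + 1 by omega]
      exact Dvd.dvd.mul_left (Nat.gcd_dvd_right _ _) 4
  have e : qPoch ((RatFunc.X ^ 4) ^ m)⁻¹ (RatFunc.X ^ 4) j =
      (∏ i ∈ range j, -((RatFunc.X : RatFunc K) ^ (4 * (m - i)))⁻¹) *
        ∏ i ∈ range j, (1 - RatFunc.X ^ (4 * (m - i))) := by
    rw [qPoch, ← Finset.prod_mul_distrib]
    refine Finset.prod_congr rfl fun i hi => ?_
    have hi : i < j := by simpa using hi
    obtain ⟨l, rfl⟩ : ∃ l, m = i + l := ⟨m - i, by omega⟩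
    have hX : (RatFunc.X : RatFunc K) ≠ 0 := RatFunc.X_ne_zero
    rw [Nat.add_sub_cancel_left, pow_add, pow_mul]
    field_simp
    ring
  rw [e, mul_div_assoc]
  exact mul_mem (prod_mem fun i _ => neg_mem (inv_X_pow_mem_integralRing (by omega) _)) this

/-- The congruence holds modulo `[n]`. -/
lemma dvdNum_geom_sum [CharZero K] (m : ℕ) {b : K} (hb : ∀ k : ℕ, 0 < k → b ^ k ≠ 1)
    (hb0 : b ≠ 0) :
    DvdNum (∑ i ∈ range (4 * m + 1), X ^ i) (truncatedSum RatFunc.X (RatFunc.C b) m -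
      qPoch (RatFunc.X ^ 2) (RatFunc.X ^ 4) m / qPoch (RatFunc.X ^ 4) (RatFunc.X ^ 4) m *
        ((1 - RatFunc.X ^ (4 * m + 1)) / (1 - RatFunc.X)) * (RatFunc.X ^ m)⁻¹) := by
  have hq : ∀ i : ℕ, 0 < i → (RatFunc.X : RatFunc K) ^ i ≠ 1 := fun i hi => ratFunc_X_pow_ne_one hi
  have hX : (1 : RatFunc K) - RatFunc.X ≠ 0 :=
    sub_ne_zero.2 fun h => hq 1 one_pos (by rw [pow_one, ← h])
  have hdiv : (RatFunc.X : RatFunc K) ^ 4 / RatFunc.C b = RatFunc.C b⁻¹ * RatFunc.X ^ 4 := by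
    rw [map_inv₀, inv_mul_eq_div]
  have hn : algebraMap K[X] (RatFunc K) (∑ i ∈ range (4 * m + 1), X ^ i) =
      (1 - RatFunc.X ^ (4 * m + 1)) / (1 - RatFunc.X) := by
    rw [eq_div_iff hX, ← mul_neg_geom_sum, mul_comm]
    simp
  have hXm := X_mem_integralRing (1 - X ^ (4 * m + 1) : K[X])
  have hb1 := hb (4 * m + 1) (by omega)
  rw [truncatedSum_eq RatFunc.X_ne_zero hq ((_root_.map_ne_zero _).2 hb0)
    (by rw [hdiv]; exact qPoch_C_mul_ne_zero _) (qPoch_C_mul_ne_zero _), ← hn,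
    mul_comm (_ / _) (algebraMap _ _ _), mul_assoc (algebraMap _ _ _) (_ / _), ← mul_sub]
  refine dvdNum_mul (Dvd.intro_left (1 - X) (mul_neg_geom_sum _ _)) (sub_mem (mul_mem (mul_mem
    (pow_mem (qPoch_X_div_mem m) 2) (inv_X_pow_mem_integralRing (by omega) m))
    (sum_mem fun j hj => ?_)) (mul_mem (qPoch_X_sq_div_mem m)
    (inv_X_pow_mem_integralRing (by omega) m)))
  have hj : j ≤ m := by simpa [Nat.lt_succ_iff] using hj
  rw [div_eq_mul_inv _ (_ * _), mul_inv, hdiv]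
  refine mul_mem (mul_mem (mul_mem (one_sub_pow_div_mem (by omega) (Nat.gcd_dvd_right _ _))
    (qPoch_inv_X_pow_div_mem hj)) (mul_mem (mul_mem ?_ ?_) (pow_mem (pow_mem hXm 4) j)))
    (mul_mem (inv_qPoch_C_mul_mem (by rwa [inv_pow, ne_eq, inv_eq_one]) j)
      (inv_qPoch_C_mul_mem hb1 j))
  · exact qPoch_mem _ (mul_mem hXm (pow_mem (pow_mem hXm 4) _)) (pow_mem hXm 4) j
  · exact qPoch_mem _ (pow_mem hXm 3) (pow_mem hXm 4) j

end Integrality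

lemma irreducible_X_pow_sub_C_of_intDegree {n : ℕ} (hn : Odd n) {b : RatFunc ℚ}
    (hb : IsUnit b.intDegree) : Irreducible (X ^ n - C b : (RatFunc ℚ)[X]) := by
  refine X_pow_sub_C_irreducible_of_odd hn fun p hp _ c h => ?_
  have hpow : ∀ k : ℕ, c ≠ 0 → (c ^ k).intDegree = k * c.intDegree := fun k hc => by
    induction k with
    | zero => simp
    | succ k ih =>
      rw [pow_succ, RatFunc.intDegree_mul (pow_ne_zero k hc) hc, ih]
      push_cast
      ring
  have hc : c ≠ 0 := by
    rintro rfl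
    rw [← h, zero_pow hp.ne_zero, RatFunc.intDegree_zero] at hb
    exact not_isUnit_zero hb
  rw [← h, hpow p hc] at hb
  exact hp.one_lt.ne' (by simpa using Int.isUnit_iff_natAbs_eq.1 (isUnit_of_mul_isUnit_left hb))

/-- Parametric generalization of Theorem 1 (Theorem 3, eq. (2.3) of the paper):
congruence modulo `[n](1-aqⁿ)(a-qⁿ)`. -/
theorem stmt5 (n : ℕ) (hn : 0 < n) (hn4 : n % 4 = 1) :
    let q : RatFunc (RatFunc ℚ) := RatFunc.X
    let a : RatFunc (RatFunc ℚ) := RatFunc.C RatFunc.X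
    ratCongr2 ((∑ i ∈ Finset.range n, (X : Polynomial (RatFunc ℚ)) ^ i) *
        (1 - C (RatFunc.X : RatFunc ℚ) * X ^ n) * (C (RatFunc.X : RatFunc ℚ) - X ^ n))
      ((∑ k ∈ Finset.range ((n - 1) / 4 + 1),
          qInt q (8 * (k : ℤ) + 1) *
            (qPoch q (q ^ 4) k ^ 2 * qPoch (a * q) (q ^ 4) k * qPoch (q / a) (q ^ 4) k) /
            (qPoch (q ^ 4) (q ^ 4) k ^ 2 * qPoch (a * q ^ 4) (q ^ 4) k *
              qPoch (q ^ 4 / a) (q ^ 4) k) * q ^ (2 * k)) -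
        qPoch (q ^ 2) (q ^ 4) ((n - 1) / 4) / qPoch (q ^ 4) (q ^ 4) ((n - 1) / 4) *
          qInt q (n : ℤ) * q ^ ((1 - (n : ℤ)) / 4)) := by
  intro q a
  obtain ⟨m, rfl⟩ : ∃ m, n = 4 * m + 1 := ⟨n / 4, by omega⟩
  rw [show (4 * m + 1 - 1) / 4 = m by omega, qInt_natCast,
    show (1 - ((4 * m + 1 : ℕ) : ℤ)) / 4 = -(m : ℤ) by push_cast; omega, zpow_neg, zpow_natCast]
  have hX0 : (RatFunc.X : RatFunc ℚ) ≠ 0 := RatFunc.X_ne_zero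
  have hX : ∀ k : ℕ, 0 < k → (RatFunc.X : RatFunc ℚ) ^ k ≠ 1 := fun k hk => ratFunc_X_pow_ne_one hk
  have hX' : ∀ k : ℕ, 0 < k → (RatFunc.X : RatFunc ℚ)⁻¹ ^ k ≠ 1 := fun k hk => by
    rw [inv_pow, ne_eq, inv_eq_one]
    exact hX k hk
  have hodd : Odd (4 * m + 1) := ⟨2 * m, by ring⟩
  have d1 := dvdNum_geom_sum m hX hX0
  have d2 := dvdNum_X_pow_sub_C (m := m) hX'
    (irreducible_X_pow_sub_C_of_intDegree hodd (by rw [RatFunc.intDegree_inv]; simp))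
    (inv_ne_zero hX0)
  have d3 := dvdNum_X_pow_sub_C (m := m) hX
    (irreducible_X_pow_sub_C_of_intDegree hodd (by simp)) hX0
  rw [inv_inv] at d2
  rw [map_inv₀, truncatedSum_inv] at d3
  have cop : ∀ b c : RatFunc ℚ, b ≠ c →
      IsCoprime (X ^ (4 * m + 1) - C b) (X ^ (4 * m + 1) - C c : (RatFunc ℚ)[X]) := fun b c h => by
    have e : C ((c - b)⁻¹) * (C c - C b) = 1 := by
      rw [← C_sub, ← C_mul, inv_mul_cancel₀ (sub_ne_zero.2 h.symm), C_1]
    exact ⟨C ((c - b)⁻¹), -C ((c - b)⁻¹), by linear_combination e⟩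
  have cop1 : ∀ b : RatFunc ℚ, b ≠ 1 → IsCoprime (∑ i ∈ range (4 * m + 1), X ^ i)
      (X ^ (4 * m + 1) - C b : (RatFunc ℚ)[X]) := fun b h => by
    refine (cop 1 b h.symm).of_isCoprime_of_dvd_left ⟨X - 1, ?_⟩
    rw [geom_sum_mul, C_1]
  have h1 : (RatFunc.X : RatFunc ℚ) ≠ 1 := by simpa using hX 1 one_pos
  have h2 : (RatFunc.X : RatFunc ℚ)⁻¹ ≠ 1 := by simpa using hX' 1 one_pos
  have h3 : (RatFunc.X : RatFunc ℚ)⁻¹ ≠ RatFunc.X := fun h => hX 2 two_pos (by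
    rw [pow_two]
    nth_rw 1 [← h]
    exact inv_mul_cancel₀ hX0)
  have key := ((d1.mul (cop1 _ h2) d2).mul ((cop1 _ h1).mul_left (cop _ _ h3)) d3).isUnit_mul
    (isUnit_C.2 hX0.isUnit)
  have e : C (RatFunc.X : RatFunc ℚ) * C (RatFunc.X : RatFunc ℚ)⁻¹ = 1 := by
    rw [← C_mul, mul_inv_cancel₀ hX0, C_1]
  have hM : (∑ i ∈ range (4 * m + 1), (X : (RatFunc ℚ)[X]) ^ i) *
      (1 - C (RatFunc.X : RatFunc ℚ) * X ^ (4 * m + 1)) *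
      (C (RatFunc.X : RatFunc ℚ) - X ^ (4 * m + 1)) =
      C RatFunc.X * ((∑ i ∈ range (4 * m + 1), X ^ i) * (X ^ (4 * m + 1) - C RatFunc.X⁻¹) *
        (X ^ (4 * m + 1) - C RatFunc.X)) := by
    linear_combination (∑ i ∈ range (4 * m + 1), (X : (RatFunc ℚ)[X]) ^ i) *
      (X ^ (4 * m + 1) - C (RatFunc.X : RatFunc ℚ)) * e
  rw [hM]
  exact key
end
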